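/- arXiv:1903.11395 — 13 statements merged into one kernel-verified Lean document; each statement's English description precedes it below -/
import Mathlib

section
/- Assume Δ_{k−1} ≠ 0 and Δ_k = Δ_{k+1} = ⋯ = Δ_{k+j−1} = 0 for some j ≥ 1, and let c = (c_0,…,c_{k−1})ᵀ be the unique solution of H_{k−1} c = −(m_k,…, m_{2k−1})ᵀ. Then Δ_{k+j} = 0 if and only if −m_{2k+j} = c_0 m_{k+j} + c_1 m_{k+j+1} + ⋯ + c_{k−1} m_{2k+j−1}. -/
open Polynomial Matrix

/-- `hankelDet m k` is the determinant of the `k × k` Hankel matrix with `(i,j)` entry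
`m (i + j)` (0-indexed), i.e. the determinant `Δ_{k-1}` of the paper
(with `hankelDet m 0 = Δ_{-1} = 1`). -/
noncomputable def hankelDet (m : ℕ → ℂ) (k : ℕ) : ℂ :=
  (Matrix.of fun i j : Fin k => m ((i : ℕ) + (j : ℕ))).det

lemma hankelDet_zero_iff (m : ℕ → ℂ) (n : ℕ) :
    hankelDet m n = 0 ↔ ∃ v : ℕ → ℂ, (∃ r < n, v r ≠ 0) ∧
      ∀ s < n, ∑ r ∈ Finset.range n, v r * m (r + s) = 0 := by
  unfold hankelDet
  rw [← Matrix.exists_vecMul_eq_zero_iff]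
  constructor
  · rintro ⟨v, hv, h⟩
    refine ⟨fun r => if h : r < n then v ⟨r, h⟩ else 0, ?_, ?_⟩
    · obtain ⟨i, hi⟩ := Function.ne_iff.mp hv
      exact ⟨i, i.2, by simpa using hi⟩
    · intro s hs
      have := congrFun h ⟨s, hs⟩
      rw [← Fin.sum_univ_eq_sum_range
        (fun r => (if h : r < n then v ⟨r, h⟩ else 0) * m (r + s)) n]
      simpa [Matrix.vecMul, dotProduct] using this
  · rintro ⟨v, ⟨r, hr, hv⟩, h⟩
    refine ⟨fun i => v i, fun h0 => hv (congrFun h0 ⟨r, hr⟩), ?_⟩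
    ext s
    have := h s s.2
    rw [← Fin.sum_univ_eq_sum_range (fun r => v r * m (r + s)) n] at this
    simpa [Matrix.vecMul, dotProduct] using this

lemma hankel_step (m : ℕ → ℂ) (k t : ℕ) (hΔ : hankelDet m k ≠ 0) (c : ℕ → ℂ)
    (e : ℕ → ℂ) (he : ∀ n, e n = m (k + n) + ∑ i ∈ Finset.range k, c i * m (n + i))
    (h0 : ∀ n < k + t, e n = 0) :
    hankelDet m (k + t + 1) = 0 ↔ e (k + t) = 0 := by
  constructor
  · intro hdet
    by_contra hne
    obtain ⟨v, ⟨r0, hr0, hv0⟩, hv⟩ := (hankelDet_zero_iff _ _).1 hdet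
    have hE : ∀ s ≤ t, ∑ r ∈ Finset.range (k + t + 1), v r * e (r + s) = 0 := by
      intro s hs
      have h1 : ∀ r, v r * e (r + s) = v r * m (r + (k + s)) +
          ∑ i ∈ Finset.range k, c i * (v r * m (r + (s + i))) := by
        intro r
        rw [he, mul_add, Finset.mul_sum]
        congr 1
        · congr 2; omega
        · refine Finset.sum_congr rfl fun i _ => ?_
          rw [add_assoc]; ring
      simp_rw [h1]
      rw [Finset.sum_add_distrib, hv _ (by omega), Finset.sum_comm, zero_add]
      refine Finset.sum_eq_zero fun i hi => ?_
      rw [← Finset.mul_sum, hv _ (by have := Finset.mem_range.1 hi; omega), mul_zero]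
    have hz : ∀ s ≤ t, v (k + t - s) = 0 := by
      intro s
      induction s using Nat.strong_induction_on with
      | _ s ih =>
        intro hs
        have h2 := hE s hs
        rw [Finset.sum_eq_single (k + t - s)] at h2
        · rw [show k + t - s + s = k + t by omega] at h2
          exact (mul_eq_zero.1 h2).resolve_right hne
        · intro r hr hrne
          have hr := Finset.mem_range.1 hr
          rcases lt_or_gt_of_ne hrne with h | h
          · rw [h0 _ (by omega), mul_zero]
          · have := ih (k + t - r) (by omega) (by omega)
            rw [show k + t - (k + t - r) = r by omega] at this
            rw [this, zero_mul]
        · intro h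
          exact absurd (Finset.mem_range.2 (by omega)) h
    have hz' : ∀ r, k ≤ r → r < k + t + 1 → v r = 0 := by
      intro r h1 h2
      have := hz (k + t - r) (by omega)
      rwa [show k + t - (k + t - r) = r by omega] at this
    apply hΔ
    rw [hankelDet_zero_iff]
    refine ⟨v, ⟨r0, ?_, hv0⟩, ?_⟩
    · by_contra h
      exact hv0 (hz' _ (by omega) hr0)
    · intro s hs
      rw [← hv s (by omega)]
      refine Finset.sum_subset (Finset.range_mono (by omega)) fun r h1 h2 => ?_
      rw [hz' r (by simpa using h2) (by simpa using h1), zero_mul]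
  · intro hz
    rw [hankelDet_zero_iff]
    refine ⟨fun r => if r < k then c r else if r = k then 1 else 0,
      ⟨k, by omega, by simp⟩, ?_⟩
    intro s hs
    have hes : e s = 0 := by
      rcases Nat.lt_succ_iff_lt_or_eq.1 hs with h | h
      · exact h0 s h
      · rw [h, hz]
    refine Eq.trans ?_ hes
    rw [he, add_comm (m _)]
    rw [← Finset.sum_subset (Finset.range_mono (show k + 1 ≤ k + t + 1 by omega)),
      Finset.sum_range_succ]
    · simp only [lt_irrefl, if_true, if_false, one_mul]
      congr 1
      refine Finset.sum_congr rfl fun i hi => ?_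
      rw [if_pos (Finset.mem_range.1 hi), add_comm i]
    · intro r _ h2
      have h2 : k + 1 ≤ r := by simpa using h2
      simp only [if_neg (show ¬ r < k by omega), if_neg (show ¬ r = k by omega), zero_mul]

/-- Assume `Δ_{k−1} ≠ 0` and `Δ_k = ⋯ = Δ_{k+j−1} = 0` for some `j ≥ 1`,
and let `c` be the (unique) solution of `H_{k−1} c = −(m_k, …, m_{2k−1})ᵀ`.
Then `Δ_{k+j} = 0` iff `−m_{2k+j} = c_0 m_{k+j} + ⋯ + c_{k−1} m_{2k+j−1}`. -/
theorem stmt1 (L : Polynomial ℂ →ₗ[ℂ] ℂ) (m : ℕ → ℂ) (hm : ∀ i, m i = L (X ^ i))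
    (k j : ℕ) (hk : 1 ≤ k) (hj : 1 ≤ j)
    (hΔ : hankelDet m k ≠ 0)
    (hzeros : ∀ i < j, hankelDet m (k + 1 + i) = 0)
    (c : Fin k → ℂ)
    (hc : (Matrix.of fun r s : Fin k => m ((r : ℕ) + (s : ℕ))).mulVec c =
      fun r : Fin k => -m (k + (r : ℕ))) :
    hankelDet m (k + j + 1) = 0 ↔
      -m (2 * k + j) = ∑ i : Fin k, c i * m (k + j + (i : ℕ)) := by
  set c' : ℕ → ℂ := fun i => if h : i < k then c ⟨i, h⟩ else 0 with hc'
  have hsum : ∀ n, ∑ i ∈ Finset.range k, c' i * m (n + i) = ∑ i : Fin k, c i * m (n + i) := by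
    intro n
    rw [← Fin.sum_univ_eq_sum_range (fun i => c' i * m (n + i)) k]
    simp [hc']
  set e : ℕ → ℂ := fun n => m (k + n) + ∑ i ∈ Finset.range k, c' i * m (n + i) with he
  have hlow : ∀ n < k, e n = 0 := by
    intro n hn
    have h := congrFun hc ⟨n, hn⟩
    simp only [Matrix.mulVec, dotProduct, Matrix.of_apply] at h
    simp only [he, hsum]
    simp_rw [mul_comm (c _), h]
    ring
  have key : ∀ t ≤ j, ∀ n < k + t, e n = 0 := by
    intro t
    induction t with
    | zero => intro _ n hn; exact hlow n hn
    | succ t ih =>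
      intro ht n hn
      have ih := ih (by omega)
      have hz := hzeros t (by omega)
      rw [show k + 1 + t = k + t + 1 by omega] at hz
      have := (hankel_step m k t hΔ c' e (fun _ => rfl) ih).1 hz
      rcases Nat.lt_succ_iff_lt_or_eq.1 (show n < (k + t).succ by omega) with h | h
      · exact ih n h
      · rw [h, this]
  rw [hankel_step m k j hΔ c' e (fun _ => rfl) (key j le_rfl)]
  simp only [he, hsum]
  rw [show k + (k + j) = 2 * k + j by omega, add_eq_zero_iff_neg_eq]
end

section
/- Assume Δ_{k−1} ≠ 0 and Δ_k = Δ_{k+1} = ⋯ = Δ_{k+j−1} = 0 for some j ≥ 1. Then the linear system H_{k+j−1} b = −(m_{k+j}, m_{k+j+1},…, m_{2k+2j−1})ᵀ has a solution (and then infinitely many solutions) if and only if Δ_{k+j} = Δ_{k+j+1} = ⋯ = Δ_{k+2j−1} = 0. -/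
open Polynomial Matrix

/-- polynomial with given coefficients -/
noncomputable def polyOf {N : ℕ} (v : Fin N → ℂ) : ℂ[X] := ∑ t : Fin N, C (v t) * X ^ (t : ℕ)

lemma polyOf_degree {N : ℕ} (v : Fin N → ℂ) : (polyOf v).degree < N :=
  Polynomial.degree_sum_fin_lt v

lemma polyOf_coeff {N : ℕ} (v : Fin N → ℂ) (t : Fin N) : (polyOf v).coeff t = v t := by
  simp [polyOf, finsetSum_coeff, coeff_C_mul, coeff_X_pow, Fin.val_inj]

lemma L_mul_pow (L : ℂ[X] →ₗ[ℂ] ℂ) (q : ℂ[X]) (n a : ℕ) (f : ℂ[X]) (hq : q.degree < n) :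
    L (q * (X ^ a * f)) = ∑ i ∈ Finset.range n, q.coeff i * L (f * X ^ (i + a)) := by
  have h : q = ∑ i ∈ Finset.range n, monomial i (q.coeff i) := by
    by_cases hq0 : q = 0
    · simp [hq0]
    · exact q.as_sum_range' n ((natDegree_lt_iff_degree_lt hq0).2 hq)
  conv_lhs => rw [h]
  rw [Finset.sum_mul, map_sum]
  refine Finset.sum_congr rfl fun i _ => ?_
  rw [← C_mul_X_pow_eq_monomial, show C (q.coeff i) * X ^ i * (X ^ a * f)
    = q.coeff i • (f * X ^ (i + a)) by rw [smul_eq_C_mul]; ring, map_smul, smul_eq_mul]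

lemma mulVec_poly (L : ℂ[X] →ₗ[ℂ] ℂ) (m : ℕ → ℂ) (hm : ∀ i, m i = L (X ^ i)) {N : ℕ}
    (v : Fin N → ℂ) (r : Fin N) :
    (Matrix.of fun r s : Fin N => m ((r : ℕ) + (s : ℕ))).mulVec v r
      = L (polyOf v * X ^ (r : ℕ)) := by
  simp only [polyOf, Matrix.mulVec, dotProduct, Matrix.of_apply, hm, Finset.sum_mul, map_sum]
  refine Finset.sum_congr rfl fun i _ => ?_
  rw [show C (v i) * X ^ (i : ℕ) * X ^ (r : ℕ) = v i • (X ^ ((r : ℕ) + (i : ℕ)) : ℂ[X]) by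
    rw [smul_eq_C_mul]; ring, map_smul, smul_eq_mul, mul_comm]

lemma polyOf_coeff_eq (N : ℕ) (f : ℂ[X]) (hf : f.degree < N) :
    polyOf (fun t : Fin N => f.coeff t) = f := by
  ext n
  by_cases hn : n < N
  · exact polyOf_coeff (fun t : Fin N => f.coeff t) ⟨n, hn⟩
  · have hN : (N : WithBot ℕ) ≤ n := by exact_mod_cast not_lt.1 hn
    rw [coeff_eq_zero_of_degree_lt (lt_of_lt_of_le (polyOf_degree _) hN),
      coeff_eq_zero_of_degree_lt (lt_of_lt_of_le hf hN)]

lemma det_zero_iff (L : ℂ[X] →ₗ[ℂ] ℂ) (m : ℕ → ℂ) (hm : ∀ i, m i = L (X ^ i)) (N : ℕ) :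
    hankelDet m N = 0 ↔ ∃ q : ℂ[X], q ≠ 0 ∧ q.degree < N ∧ ∀ i < N, L (q * X ^ i) = 0 := by
  rw [hankelDet, ← Matrix.exists_mulVec_eq_zero_iff]
  constructor
  · rintro ⟨v, hv, h⟩
    refine ⟨polyOf v, ?_, polyOf_degree v, fun i hi => ?_⟩
    · intro h0
      apply hv
      funext t
      rw [← polyOf_coeff v t, h0]; simp
    · have := congrFun h ⟨i, hi⟩
      rwa [mulVec_poly L m hm] at this
  · rintro ⟨q, hq, hd, h⟩
    refine ⟨fun t => q.coeff t, ?_, ?_⟩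
    · intro h0
      apply hq
      rw [← polyOf_coeff_eq N q hd, h0]
      simp [polyOf]
    · funext r
      rw [mulVec_poly L m hm, polyOf_coeff_eq N q hd]
      exact h r r.2

lemma system_iff (L : ℂ[X] →ₗ[ℂ] ℂ) (m : ℕ → ℂ) (hm : ∀ i, m i = L (X ^ i)) (N : ℕ)
    (b : Fin N → ℂ) :
    ((Matrix.of fun r s : Fin N => m ((r : ℕ) + (s : ℕ))).mulVec b =
          fun r : Fin N => -m (N + (r : ℕ))) ↔
      ∀ i < N, L ((X ^ N + polyOf b) * X ^ i) = 0 := by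
  have key : ∀ i, L ((X ^ N + polyOf b) * X ^ i) = L (polyOf b * X ^ i) + m (N + i) := by
    intro i
    rw [add_mul, map_add, ← pow_add, hm, add_comm]
  constructor
  · intro h i hi
    have := congrFun h ⟨i, hi⟩
    rw [mulVec_poly L m hm] at this
    rw [key, this]; simp
  · intro h
    funext r
    rw [mulVec_poly L m hm]
    have := h r r.2
    rw [key] at this
    exact eq_neg_of_add_eq_zero_left this

/-- orthogonality, extended by linearity -/
lemma L_mul_zero (L : ℂ[X] →ₗ[ℂ] ℂ) (N : ℕ) (q f : ℂ[X]) (hq : ∀ i < N, L (q * X ^ i) = 0)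
    (hf : f.degree < N) : L (q * f) = 0 := by
  have := L_mul_pow L f N 0 q hf
  rw [pow_zero, one_mul, mul_comm] at this
  rw [this]
  refine Finset.sum_eq_zero fun i hi => ?_
  rw [add_zero, hq i (Finset.mem_range.1 hi), mul_zero]

lemma L_mul_top (L : ℂ[X] →ₗ[ℂ] ℂ) (q p : ℂ[X]) (n a : ℕ)
    (hq : q.degree < ((n + 1 : ℕ) : WithBot ℕ))
    (hp : ∀ i < n + a, L (p * X ^ i) = 0) :
    L (q * (X ^ a * p)) = q.coeff n * L (p * X ^ (n + a)) := by
  rw [L_mul_pow L q (n + 1) a p hq, Finset.sum_range_succ, Finset.sum_eq_zero, zero_add]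
  intro i hi
  rw [hp _ (by have := Finset.mem_range.1 hi; omega), mul_zero]

lemma deg_pow_mul {p : ℂ[X]} {k a N : ℕ} (hp : p.degree = k) (h : a + k < N) :
    (X ^ a * p).degree < (N : WithBot ℕ) := by
  rw [degree_mul, degree_X_pow, hp]; exact_mod_cast h

/-- First nonvanishing determinant. -/
lemma step (L : ℂ[X] →ₗ[ℂ] ℂ) (m : ℕ → ℂ) (hm : ∀ i, m i = L (X ^ i)) (k d : ℕ) (p : ℂ[X])
    (hp : p.degree = k) (hΔ : hankelDet m k ≠ 0)
    (hs : ∀ i < k + d, L (p * X ^ i) = 0) (h0 : hankelDet m (k + d + 1) = 0) :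
    L (p * X ^ (k + d)) = 0 := by
  by_contra hne
  obtain ⟨q, hq0, hqd, hq⟩ := (det_zero_iff L m hm _).1 h0
  have main : ∀ a ≤ d + 1, q.degree < ((k + d + 1 - a : ℕ) : WithBot ℕ) := by
    intro a
    induction a with
    | zero => intro _; exact hqd
    | succ a ih =>
      intro ha
      have ih := ih (by omega)
      rw [show k + d + 1 - a = (k + d - a) + 1 by omega] at ih
      have e : k + d - a + a = k + d := by omega
      have h1 := L_mul_top L q p (k + d - a) a ih (by rw [e]; exact hs)
      rw [L_mul_zero L (k + d + 1) q _ hq (deg_pow_mul hp (by omega)), e] at h1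
      have hc : q.coeff (k + d - a) = 0 := by
        rcases mul_eq_zero.1 h1.symm with h | h
        · exact h
        · exact absurd h hne
      rw [show k + d + 1 - (a + 1) = k + d - a by omega, degree_lt_iff_coeff_zero]
      intro n hn
      rcases hn.eq_or_lt with rfl | hn
      · exact hc
      · exact (degree_lt_iff_coeff_zero _ _).1 ih n hn
  have := main (d + 1) le_rfl
  rw [show k + d + 1 - (d + 1) = k by omega] at this
  exact hΔ ((det_zero_iff L m hm k).2 ⟨q, hq0, this, fun i hi => hq i (by omega)⟩)

lemma chain (L : ℂ[X] →ₗ[ℂ] ℂ) (m : ℕ → ℂ) (hm : ∀ i, m i = L (X ^ i)) (k d : ℕ) (p : ℂ[X])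
    (hp : p.degree = k) (hΔ : hankelDet m k ≠ 0)
    (hs : ∀ i < k, L (p * X ^ i) = 0) (h0 : ∀ i < d, hankelDet m (k + 1 + i) = 0) :
    ∀ i < k + d, L (p * X ^ i) = 0 := by
  induction d with
  | zero => exact hs
  | succ d ih =>
    have ih := ih fun i hi => h0 i (by omega)
    intro i hi
    rcases (show i ≤ k + d by omega).eq_or_lt with rfl | h
    · refine step L m hm k d p hp hΔ ih ?_
      rw [show k + d + 1 = k + 1 + d by ring]
      exact h0 d (by omega)
    · exact ih i h

/-- Assume `Δ_{k−1} ≠ 0` and `Δ_k = ⋯ = Δ_{k+j−1} = 0` for some `j ≥ 1`.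
Then the linear system `H_{k+j−1} b = −(m_{k+j}, …, m_{2k+2j−1})ᵀ` has a solution
(and then infinitely many solutions) iff `Δ_{k+j} = Δ_{k+j+1} = ⋯ = Δ_{k+2j−1} = 0`. -/
theorem stmt2 (L : Polynomial ℂ →ₗ[ℂ] ℂ) (m : ℕ → ℂ) (hm : ∀ i, m i = L (X ^ i))
    (k j : ℕ) (hk : 1 ≤ k) (hj : 1 ≤ j)
    (hΔ : hankelDet m k ≠ 0)
    (hzeros : ∀ i < j, hankelDet m (k + 1 + i) = 0) :
    ((∃ b : Fin (k + j) → ℂ,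
        (Matrix.of fun r s : Fin (k + j) => m ((r : ℕ) + (s : ℕ))).mulVec b =
          fun r : Fin (k + j) => -m (k + j + (r : ℕ))) ↔
      (∀ i < j, hankelDet m (k + j + 1 + i) = 0)) ∧
    ((∀ i < j, hankelDet m (k + j + 1 + i) = 0) →
      {b : Fin (k + j) → ℂ |
        (Matrix.of fun r s : Fin (k + j) => m ((r : ℕ) + (s : ℕ))).mulVec b =
          fun r : Fin (k + j) => -m (k + j + (r : ℕ))}.Infinite) := by
  classical
  have exP : ∃ p : ℂ[X], p.Monic ∧ p.degree = k ∧ ∀ i < k, L (p * X ^ i) = 0 := by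
    set H := (Matrix.of fun r s : Fin k => m ((r : ℕ) + (s : ℕ))) with hH
    have hu : IsUnit H.det := isUnit_iff_ne_zero.2 hΔ
    have hb : H.mulVec (H⁻¹.mulVec fun r : Fin k => -m (k + (r : ℕ)))
        = fun r : Fin k => -m (k + (r : ℕ)) := by
      rw [Matrix.mulVec_mulVec, Matrix.mul_nonsing_inv _ hu, Matrix.one_mulVec]
    set b := H⁻¹.mulVec fun r : Fin k => -m (k + (r : ℕ))
    refine ⟨X ^ k + polyOf b, monic_X_pow_add (polyOf_degree b), ?_,
      (system_iff L m hm k b).1 hb⟩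
    rw [degree_add_eq_left_of_degree_lt, degree_X_pow]
    rw [degree_X_pow]; exact polyOf_degree b
  obtain ⟨p, hpm, hp, hs⟩ := exP
  have hs1 := chain L m hm k j p hp hΔ hs hzeros
  have imp1 : (∀ i < j, hankelDet m (k + j + 1 + i) = 0) →
      ∀ i < k + (j + j), L (p * X ^ i) = 0 := by
    intro h
    refine chain L m hm k (j + j) p hp hΔ hs fun i hi => ?_
    by_cases hij : i < j
    · exact hzeros i hij
    · have := h (i - j) (by omega)
      rwa [show k + j + 1 + (i - j) = k + 1 + i by omega] at this
  have inf : (∀ i < j, hankelDet m (k + j + 1 + i) = 0) →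
      {b : Fin (k + j) → ℂ |
        (Matrix.of fun r s : Fin (k + j) => m ((r : ℕ) + (s : ℕ))).mulVec b =
          fun r : Fin (k + j) => -m (k + j + (r : ℕ))}.Infinite := by
    intro h
    have hs2 := imp1 h
    have hdj : (X ^ j * p).degree = ((k + j : ℕ) : WithBot ℕ) := by
      rw [degree_mul, degree_X_pow, hp, ← Nat.cast_add, add_comm]
    have hmj : (X ^ j * p).Monic := (monic_X_pow j).mul hpm
    refine Set.infinite_of_injective_forall_mem
      (f := fun c : ℂ => fun t : Fin (k + j) => (X ^ j * p - X ^ (k + j) + C c * p).coeff t)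
      ?_ ?_
    · intro c c' hcc
      have := congrFun hcc ⟨k, by omega⟩
      have hpk : p.coeff k = 1 := by
        have := hpm.coeff_natDegree
        rwa [natDegree_eq_of_degree_eq_some hp] at this
      simpa only [coeff_add, coeff_C_mul, hpk, mul_one, add_right_inj] using this
    · intro c
      rw [Set.mem_ofPred_eq, system_iff L m hm, polyOf_coeff_eq]
      · intro i hi
        rw [show (X ^ (k + j) + (X ^ j * p - X ^ (k + j) + C c * p)) * X ^ i
          = p * X ^ (i + j) + c • (p * X ^ i) by rw [smul_eq_C_mul]; ring, map_add, map_smul,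
          hs2 _ (by omega), hs1 i hi]
        simp
      · refine lt_of_le_of_lt (degree_add_le _ _) (max_lt ?_ ?_)
        · rw [← hdj]
          refine degree_sub_lt_left ?_ hmj.ne_zero ?_
          · rw [hdj, degree_X_pow]
          · rw [hmj.leadingCoeff, (monic_X_pow _).leadingCoeff]
        · refine lt_of_le_of_lt (show (C c * p).degree ≤ p.degree by rw [← smul_eq_C_mul]; exact degree_smul_le c p) ?_
          rw [hp]; exact_mod_cast (by omega : k < k + j)
  refine ⟨⟨?_, fun h => (inf h).nonempty⟩, inf⟩
  rintro ⟨b, hb⟩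
  rw [system_iff L m hm] at hb
  have hqd : (X ^ (k + j) + polyOf b).degree < ((k + j + 1 : ℕ) : WithBot ℕ) := by
    rw [degree_add_eq_left_of_degree_lt, degree_X_pow]
    · exact_mod_cast Nat.lt_succ_self _
    · rw [degree_X_pow]; exact polyOf_degree b
  have hqc : (X ^ (k + j) + polyOf b).coeff (k + j) = 1 := by
    rw [coeff_add, coeff_X_pow_self, coeff_eq_zero_of_degree_lt (polyOf_degree b), add_zero]
  have hall : ∀ a ≤ j, ∀ i < k + j + a, L (p * X ^ i) = 0 := by
    intro a
    induction a with
    | zero => intro _; exact hs1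
    | succ a ih =>
      intro ha
      have ih := ih (by omega)
      intro i hi
      rcases (show i ≤ k + j + a by omega).eq_or_lt with rfl | h
      · have h1 := L_mul_top L _ p (k + j) a hqd ih
        rw [L_mul_zero L (k + j) _ _ hb (deg_pow_mul hp (by omega)), hqc, one_mul] at h1
        exact h1.symm
      · exact ih i h
  intro i hi
  refine (det_zero_iff L m hm _).2 ⟨p, hpm.ne_zero, ?_, fun t ht => hall j le_rfl t (by omega)⟩
  rw [hp]; exact_mod_cast (by omega : k < k + j + 1 + i)
end

section
/- A monic formal orthogonal polynomial of degree n with respect to L exists if and only if one of the following holds: (i) Δ_{n−1} ≠ 0, in which case it is unique; or (ii) there exists k with 0 ≤ k ≤ n−1 such that Δ_{k−1} ≠ 0 and Δ_k = Δ_{k+1} = ⋯ = Δ_{n−1} = ⋯ = Δ_{2n−k−1} = 0, in which case there exist infinitely many monic formal orthogonal polynomials of degree n. -/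
open Polynomial Matrix

namespace FOPaux

lemma L_expand (L : Polynomial ℂ →ₗ[ℂ] ℂ) (p q : Polynomial ℂ) (s : ℕ) (hq : q.natDegree < s) :
    L (p * q) = ∑ i ∈ Finset.range s, q.coeff i * L (p * X ^ i) := by
  conv_lhs => rw [q.as_sum_range' s hq]
  rw [Finset.mul_sum, map_sum]
  refine Finset.sum_congr rfl fun i _ => ?_
  rw [← C_mul_X_pow_eq_monomial, mul_left_comm, ← smul_eq_C_mul, map_smul, smul_eq_mul]

lemma L_top (L : Polynomial ℂ →ₗ[ℂ] ℂ) (P a : Polynomial ℂ) (r : ℕ)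
    (h : ∀ j < r, L (P * X ^ j) = 0) (ha : a.natDegree ≤ r) :
    L (P * a) = a.coeff r * L (P * X ^ r) := by
  rw [L_expand L P a (r + 1) (by omega), Finset.sum_range_succ, Finset.sum_eq_zero, zero_add]
  intro i hi
  rw [h i (Finset.mem_range.1 hi), mul_zero]

lemma L_zero (L : Polynomial ℂ →ₗ[ℂ] ℂ) (P a : Polynomial ℂ) (r : ℕ)
    (h : ∀ j < r, L (P * X ^ j) = 0) (ha : a.natDegree < r) :
    L (P * a) = 0 := by
  rw [L_top L P a r h ha.le, coeff_eq_zero_of_natDegree_lt ha, zero_mul]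

/-- matrix-vector product in terms of polynomials -/
noncomputable def toPoly {s : ℕ} (v : Fin s → ℂ) : Polynomial ℂ := ∑ i : Fin s, C (v i) * X ^ (i : ℕ)

lemma L_toPoly (L : Polynomial ℂ →ₗ[ℂ] ℂ) (m : ℕ → ℂ) (hm : ∀ i, m i = L (X ^ i)) {s : ℕ}
    (v : Fin s → ℂ) (j : Fin s) :
    L (toPoly v * X ^ (j : ℕ)) =
      ((Matrix.of fun i j : Fin s => m ((i : ℕ) + (j : ℕ))) *ᵥ v) j := by
  simp only [toPoly, Finset.sum_mul, map_sum, Matrix.mulVec, dotProduct, Matrix.of_apply]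
  refine Finset.sum_congr rfl fun i _ => ?_
  rw [hm, mul_assoc, ← pow_add, ← smul_eq_C_mul, map_smul, smul_eq_mul, mul_comm, add_comm]

lemma toPoly_degree {s : ℕ} (v : Fin s → ℂ) : (toPoly v).degree < s := by
  unfold toPoly
  refine lt_of_le_of_lt (degree_sum_le _ _) ?_
  refine (Finset.sup_lt_iff (WithBot.bot_lt_coe s)).2 ?_
  intro i _
  exact lt_of_le_of_lt (degree_C_mul_X_pow_le _ _) (WithBot.coe_lt_coe.2 i.2)

lemma toPoly_coeff {s : ℕ} (v : Fin s → ℂ) (i : Fin s) : (toPoly v).coeff i = v i := by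
  simp [toPoly, coeff_C_mul, coeff_X_pow, Fin.val_inj]

lemma toPoly_self {s : ℕ} (q : Polynomial ℂ) (hq : q.degree < s) :
    toPoly (fun i : Fin s => q.coeff i) = q := by
  ext i
  by_cases hi : i < s
  · exact toPoly_coeff (fun i : Fin s => q.coeff i) ⟨i, hi⟩
  · have h : (s : WithBot ℕ) ≤ i := by exact_mod_cast not_lt.1 hi
    rw [coeff_eq_zero_of_degree_lt (lt_of_lt_of_le (toPoly_degree _) h),
      coeff_eq_zero_of_degree_lt (lt_of_lt_of_le hq h)]

variable (L : Polynomial ℂ →ₗ[ℂ] ℂ) (m : ℕ → ℂ)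

lemma det_ker (hm : ∀ i, m i = L (X ^ i)) (s : ℕ) (hD : hankelDet m s ≠ 0) (q : Polynomial ℂ)
    (hq : q.degree < s) (h : ∀ j < s, L (q * X ^ j) = 0) : q = 0 := by
  have h1 : (fun i : Fin s => q.coeff i) = 0 := by
    apply Matrix.eq_zero_of_mulVec_eq_zero hD
    ext j
    rw [← L_toPoly L m hm, toPoly_self q hq]
    exact h j j.2
  rw [← toPoly_self q hq, h1]
  simp [toPoly]

lemma ker_det (hm : ∀ i, m i = L (X ^ i)) (s : ℕ)
    (h : ∀ q : Polynomial ℂ, q.degree < s → (∀ j < s, L (q * X ^ j) = 0) → q = 0) :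
    hankelDet m s ≠ 0 := by
  intro hD
  obtain ⟨v, hv, hv0⟩ := Matrix.exists_mulVec_eq_zero_iff.2 hD
  apply hv
  have := h (toPoly v) (toPoly_degree v) (fun j hj => by
    have := L_toPoly L m hm v ⟨j, hj⟩
    rw [hv0] at this
    exact this)
  ext i
  rw [← toPoly_coeff v i, this]
  simp

lemma exists_fop (hm : ∀ i, m i = L (X ^ i)) (s : ℕ) (hD : hankelDet m s ≠ 0) :
    ∃ p : Polynomial ℂ, p.Monic ∧ p.natDegree = s ∧ ∀ j < s, L (p * X ^ j) = 0 := by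
  set A := (Matrix.of fun i j : Fin s => m ((i : ℕ) + (j : ℕ))) with hA
  have hu : IsUnit A.det := isUnit_iff_ne_zero.2 hD
  let b : Fin s → ℂ := fun j => - m (s + j)
  refine ⟨X ^ s + toPoly (A⁻¹ *ᵥ b), monic_X_pow_add (toPoly_degree _), ?_, ?_⟩
  · apply natDegree_eq_of_degree_eq_some
    rw [degree_add_eq_left_of_degree_lt] <;> rw [degree_X_pow]
    exact toPoly_degree _
  · intro j hj
    have := L_toPoly L m hm (A⁻¹ *ᵥ b) ⟨j, hj⟩
    rw [← hA, Matrix.mulVec_mulVec, Matrix.mul_nonsing_inv _ hu, Matrix.one_mulVec] at this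
    simp only at this
    rw [add_mul, map_add, this, ← pow_add, ← hm]
    simp [b]

lemma mod_zero (hm : ∀ i, m i = L (X ^ i)) (k r : ℕ) (hD : hankelDet m k ≠ 0) (P q : Polynomial ℂ)
    (hP : P.Monic) (hk : P.natDegree = k) (h : ∀ j < r, L (P * X ^ j) = 0) (hkr : k ≤ r)
    (hq : q.natDegree ≤ r) (hqo : ∀ j < k, L (q * X ^ j) = 0) : q = P * (q /ₘ P) := by
  have e := modByMonic_add_div q P
  suffices h0 : q %ₘ P = 0 by rw [h0, zero_add] at e; exact e.symm
  apply det_ker L m hm k hD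
  · rw [← hk, ← degree_eq_natDegree hP.ne_zero]
    exact degree_modByMonic_lt q hP
  · intro j hj
    have h1 := hqo j hj
    rw [← e, add_mul, map_add, mul_assoc, L_zero L P _ r h, add_zero] at h1
    · exact h1
    · have := natDegree_mul_le (p := q /ₘ P) (q := X ^ j)
      rw [natDegree_X_pow, natDegree_divByMonic q hP] at this
      omega

/-- the first index of non-orthogonality gives the next regular index -/
lemma next_regular (hm : ∀ i, m i = L (X ^ i)) (k r : ℕ) (hD : hankelDet m k ≠ 0)
    (P : Polynomial ℂ) (hP : P.Monic) (hk : P.natDegree = k)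
    (h : ∀ j < r, L (P * X ^ j) = 0) (hkr : k ≤ r) (hr : L (P * X ^ r) ≠ 0) :
    hankelDet m (r + 1) ≠ 0 := by
  apply ker_det L m hm
  intro q hq hqo
  by_contra hq0
  have hqd : q.natDegree ≤ r := by
    have := (natDegree_lt_iff_degree_lt hq0).2 hq
    omega
  have e := mod_zero L m hm k r hD P q hP hk h hkr hqd (fun j hj => hqo j (by omega))
  have ha : q /ₘ P ≠ 0 := by
    intro h0; rw [h0, mul_zero] at e; exact hq0 e
  have had : (q /ₘ P).natDegree ≤ r := by rw [natDegree_divByMonic q hP]; omega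
  have h1 := hqo (r - (q /ₘ P).natDegree) (by omega)
  generalize q /ₘ P = a at *
  rw [e, mul_assoc] at h1
  have hd : (a * X ^ (r - a.natDegree)).natDegree = r := by
    rw [natDegree_mul ha (pow_ne_zero _ X_ne_zero), natDegree_X_pow]; omega
  rw [L_top L P _ r h hd.le] at h1
  have hc : (a * X ^ (r - a.natDegree)).coeff r ≠ 0 := by
    nth_rw 2 [← hd]
    rw [coeff_natDegree]
    exact leadingCoeff_ne_zero.2 (mul_ne_zero ha (pow_ne_zero _ X_ne_zero))
  exact (mul_ne_zero hc hr) h1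

lemma infinite_of (hm : ∀ i, m i = L (X ^ i)) (n : ℕ)
    (h : ∃ k < n, hankelDet m k ≠ 0 ∧
        ∀ s : ℕ, k + 1 ≤ s → s ≤ 2 * n - k → hankelDet m s = 0) :
    {p : Polynomial ℂ | p.Monic ∧ p.natDegree = n ∧ ∀ j < n, L (p * X ^ j) = 0}.Infinite := by
  obtain ⟨k, hkn, hD, hz⟩ := h
  obtain ⟨P, hP, hk, ho⟩ := exists_fop L m hm k hD
  have key : ∀ r, r ≤ 2 * n - k → ∀ j < r, L (P * X ^ j) = 0 := by
    intro r
    induction r with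
    | zero => intro _ j hj; omega
    | succ r ih =>
      intro hr j hj
      have ih' := ih (by omega)
      rcases Nat.lt_succ_iff_lt_or_eq.1 hj with hj | rfl
      · exact ih' j hj
      · by_contra hne
        by_cases hjk : j < k
        · exact hne (ho j hjk)
        · exact next_regular L m hm k j hD P hP hk ih' (by omega) hne (hz _ (by omega) hr)
  refine Set.infinite_of_injective_forall_mem (f := fun c : ℂ => P * (X ^ (n - k) + C c)) ?_ ?_
  · intro c d hcd
    have := mul_left_cancel₀ hP.ne_zero hcd
    exact C_injective (add_left_cancel this)
  · intro c
    have hmon : (X ^ (n - k) + C c : Polynomial ℂ).Monic := monic_X_pow_add_C c (by omega)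
    refine ⟨hP.mul hmon, ?_, ?_⟩
    · rw [hP.natDegree_mul hmon, natDegree_X_pow_add_C]; omega
    · intro j hj
      rw [mul_assoc]
      apply L_zero L P _ _ (key _ le_rfl)
      have := natDegree_mul_le (p := (X ^ (n - k) + C c : Polynomial ℂ)) (q := X ^ j)
      rw [natDegree_X_pow_add_C, natDegree_X_pow] at this
      omega

lemma cond_of (hm : ∀ i, m i = L (X ^ i)) (n : ℕ) (p : Polynomial ℂ) (hp : p.Monic)
    (hpn : p.natDegree = n) (hpo : ∀ j < n, L (p * X ^ j) = 0) (hn : hankelDet m n = 0) :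
    ∃ k < n, hankelDet m k ≠ 0 ∧
        ∀ s : ℕ, k + 1 ≤ s → s ≤ 2 * n - k → hankelDet m s = 0 := by
  classical
  have h0 : hankelDet m 0 ≠ 0 := by simp [hankelDet]
  set k := Nat.findGreatest (fun k => hankelDet m k ≠ 0) n with hkdef
  have hD : hankelDet m k ≠ 0 :=
    Nat.findGreatest_spec (P := fun k => hankelDet m k ≠ 0) (Nat.zero_le n) h0
  have hkn : k ≤ n := Nat.findGreatest_le n
  have hkn' : k < n := lt_of_le_of_ne hkn (fun h => hD (h ▸ hn))
  have hmax : ∀ s, k < s → s ≤ n → hankelDet m s = 0 := by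
    intro s h1 h2
    by_contra h3
    exact Nat.findGreatest_is_greatest h1 h2 h3
  obtain ⟨P, hP, hk, ho⟩ := exists_fop L m hm k hD
  have key : ∀ r, r ≤ 2 * n - k → ∀ j < r, L (P * X ^ j) = 0 := by
    intro r
    induction r with
    | zero => intro _ j hj; omega
    | succ r ih =>
      intro hr j hj
      have ih' := ih (by omega)
      rcases Nat.lt_succ_iff_lt_or_eq.1 hj with hj | rfl
      · exact ih' j hj
      · by_contra hne
        by_cases hjk : j < k
        · exact hne (ho j hjk)
        have hreg := next_regular L m hm k j hD P hP hk ih' (by omega) hne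
        have hjn : n ≤ j := by
          by_contra hlt
          exact hreg (hmax _ (by omega) (by omega))
        have e := mod_zero L m hm k j hD P p hP hk ih' (by omega) (by omega)
          (fun i hi => hpo i (by omega))
        have hamon : (p /ₘ P).Monic := by
          rw [e] at hp
          exact hP.of_mul_monic_left hp
        have had : (p /ₘ P).natDegree = n - k := by rw [natDegree_divByMonic p hP, hpn, hk]
        have h1 := hpo (j - (n - k)) (by omega)
        have hm2 : ((p /ₘ P) * X ^ (j - (n - k))).Monic := hamon.mul (monic_X_pow _)
        have hd : ((p /ₘ P) * X ^ (j - (n - k))).natDegree = j := by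
          rw [hamon.natDegree_mul (monic_X_pow _), natDegree_X_pow]; omega
        rw [e, mul_assoc, L_top L P _ j ih' hd.le] at h1
        have hc : ((p /ₘ P) * X ^ (j - (n - k))).coeff j = 1 := by
          have := hm2.coeff_natDegree
          rwa [hd] at this
        rw [hc, one_mul] at h1
        exact hne h1
  refine ⟨k, hkn', hD, fun s h1 h2 => ?_⟩
  by_contra h3
  refine hP.ne_zero (det_ker L m hm s h3 P ?_ (key s h2))
  rw [degree_eq_natDegree hP.ne_zero, hk]
  exact_mod_cast h1

end FOPaux

/-- A monic formal orthogonal polynomial of degree `n` with respect to `L`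
exists iff either (i) `Δ_{n−1} ≠ 0` (and then it is unique), or (ii) there is `0 ≤ k ≤ n−1`
with `Δ_{k−1} ≠ 0` and `Δ_k = ⋯ = Δ_{2n−k−1} = 0` (and then there are infinitely many). -/
theorem stmt3 (L : Polynomial ℂ →ₗ[ℂ] ℂ) (m : ℕ → ℂ) (hm : ∀ i, m i = L (X ^ i))
    (n : ℕ) :
    ({p : Polynomial ℂ | p.Monic ∧ p.natDegree = n ∧ ∀ j < n, L (p * X ^ j) = 0}.Nonempty ↔
      (hankelDet m n ≠ 0 ∨
        ∃ k < n, hankelDet m k ≠ 0 ∧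
          ∀ s : ℕ, k + 1 ≤ s → s ≤ 2 * n - k → hankelDet m s = 0)) ∧
    (hankelDet m n ≠ 0 →
      ∃! p : Polynomial ℂ,
        p ∈ {p : Polynomial ℂ | p.Monic ∧ p.natDegree = n ∧ ∀ j < n, L (p * X ^ j) = 0}) ∧
    ((∃ k < n, hankelDet m k ≠ 0 ∧
        ∀ s : ℕ, k + 1 ≤ s → s ≤ 2 * n - k → hankelDet m s = 0) →
      {p : Polynomial ℂ | p.Monic ∧ p.natDegree = n ∧ ∀ j < n, L (p * X ^ j) = 0}.Infinite) := by
  refine ⟨⟨?_, ?_⟩, ?_, FOPaux.infinite_of L m hm n⟩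
  · rintro ⟨p, hp, hpn, hpo⟩
    by_cases hn : hankelDet m n = 0
    · exact Or.inr (FOPaux.cond_of L m hm n p hp hpn hpo hn)
    · exact Or.inl hn
  · rintro (h | h)
    · exact FOPaux.exists_fop L m hm n h
    · exact (FOPaux.infinite_of L m hm n h).nonempty
  · intro hD
    obtain ⟨p, hp, hpn, hpo⟩ := FOPaux.exists_fop L m hm n hD
    refine ⟨p, ⟨hp, hpn, hpo⟩, ?_⟩
    rintro q ⟨hq, hqn, hqo⟩
    have hdq : q.degree = n := by rw [degree_eq_natDegree hq.ne_zero, hqn]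
    have hdp : p.degree = n := by rw [degree_eq_natDegree hp.ne_zero, hpn]
    refine sub_eq_zero.1 (FOPaux.det_ker L m hm n hD (q - p) ?_ ?_)
    · rw [← hdq]
      exact degree_sub_lt (by rw [hdq, hdp]) hq.ne_zero
        (by rw [hq.leadingCoeff, hp.leadingCoeff])
    · intro j hj
      rw [sub_mul, map_sub, hqo j hj, hpo j hj, sub_zero]
end

section
/- Assume Δ_{n−1} ≠ 0 and Δ_n = Δ_{n+1} = ⋯ = Δ_{n+j−1} = 0 for some j ≥ 1, and let π_n be the unique monic formal orthogonal polynomial of degree n with respect to L. Then π_n is orthogonal to all polynomials of degree at most n+j−1, i.e. L(π_n q) = 0 for every q ∈ 𝒫_{n+j−1}. -/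
open Polynomial Matrix

theorem aux_orth (L : Polynomial ℂ →ₗ[ℂ] ℂ) (p : Polynomial ℂ) (N : ℕ)
    (h : ∀ i < N, L (p * X ^ i) = 0) (q : Polynomial ℂ)
    (hq : q.degree < (N : WithBot ℕ)) : L (p * q) = 0 := by
  have hs : q = ∑ i ∈ Finset.range N, C (q.coeff i) * X ^ i := by
    ext k
    simp only [finset_sum_coeff, coeff_C_mul, coeff_X_pow]
    by_cases hk : k < N
    · simp [hk]
    · have : q.coeff k = 0 :=
        coeff_eq_zero_of_degree_lt (lt_of_lt_of_le hq (by exact_mod_cast not_lt.mp hk))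
      simp [this]
  rw [hs, Finset.mul_sum, map_sum]
  refine Finset.sum_eq_zero fun i hi => ?_
  have : p * (C (q.coeff i) * X ^ i) = q.coeff i • (p * X ^ i) := by
    rw [smul_eq_C_mul]; ring
  rw [this, map_smul, h i (Finset.mem_range.mp hi), smul_zero]

theorem aux_apply (L : Polynomial ℂ →ₗ[ℂ] ℂ) (m : ℕ → ℂ) (hm : ∀ i, m i = L (X ^ i))
    (N : ℕ) (v : Fin N → ℂ) (i : Fin N) :
    ((Matrix.of fun i j : Fin N => m ((i : ℕ) + (j : ℕ))) *ᵥ v) i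
      = L ((∑ k : Fin N, C (v k) * X ^ (k : ℕ)) * X ^ (i : ℕ)) := by
  rw [Finset.sum_mul, map_sum]
  simp only [Matrix.mulVec, dotProduct, Matrix.of_apply]
  refine Finset.sum_congr rfl fun k _ => ?_
  have : C (v k) * X ^ (k : ℕ) * X ^ (i : ℕ) = v k • (X ^ ((i : ℕ) + (k : ℕ)) : ℂ[X]) := by
    rw [smul_eq_C_mul]; ring
  rw [this, map_smul, hm, smul_eq_mul, mul_comm]

theorem aux_coeff (N : ℕ) (v : Fin N → ℂ) (i : Fin N) :
    (∑ k : Fin N, C (v k) * X ^ (k : ℕ) : ℂ[X]).coeff i = v i := by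
  simp only [finset_sum_coeff, coeff_C_mul, coeff_X_pow, Fin.val_inj]
  simp

theorem aux_deg (N : ℕ) (v : Fin N → ℂ) :
    (∑ k : Fin N, C (v k) * X ^ (k : ℕ) : ℂ[X]).degree < (N : WithBot ℕ) := by
  rw [degree_lt_iff_coeff_zero]
  intro k hk
  simp only [finset_sum_coeff, coeff_C_mul, coeff_X_pow]
  refine Finset.sum_eq_zero fun i _ => ?_
  have := i.2
  rw [if_neg (by omega), mul_zero]

theorem aux_sing (L : Polynomial ℂ →ₗ[ℂ] ℂ) (m : ℕ → ℂ) (hm : ∀ i, m i = L (X ^ i))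
    (N : ℕ) : hankelDet m N = 0 ↔ ∃ p : ℂ[X], p ≠ 0 ∧ p.degree < (N : WithBot ℕ) ∧
      ∀ i < N, L (p * X ^ i) = 0 := by
  unfold hankelDet
  rw [← Matrix.exists_mulVec_eq_zero_iff]
  constructor
  · rintro ⟨v, hv, h⟩
    refine ⟨_, ?_, aux_deg N v, fun i hi => ?_⟩
    · intro h0
      apply hv
      ext i
      rw [← aux_coeff N v i, h0]
      simp
    · rw [← aux_apply L m hm N v ⟨i, hi⟩, h]
      rfl
  · rintro ⟨p, hp, hd, h⟩
    have hs : (∑ k : Fin N, C (p.coeff k) * X ^ (k : ℕ) : ℂ[X]) = p := by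
      ext k
      by_cases hk : k < N
      · exact aux_coeff N (fun k => p.coeff k) ⟨k, hk⟩
      · have hk' : (N : WithBot ℕ) ≤ k := by exact_mod_cast not_lt.mp hk
        rw [coeff_eq_zero_of_degree_lt (lt_of_lt_of_le hd hk'),
          coeff_eq_zero_of_degree_lt (lt_of_lt_of_le (aux_deg N _) hk')]
    refine ⟨fun k => p.coeff k, ?_, ?_⟩
    · intro h0
      apply hp
      rw [← hs]
      refine Finset.sum_eq_zero fun i _ => ?_
      have : p.coeff i = 0 := congrFun h0 i
      simp [this]
    · ext i
      rw [aux_apply L m hm, hs, h i i.2]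
      rfl

/-- Assume `Δ_{n−1} ≠ 0` and `Δ_n = ⋯ = Δ_{n+j−1} = 0` for some `j ≥ 1`,
and let `π_n` be the unique monic FOP of degree `n` w.r.t. `L`. Then `L (π_n q) = 0`
for every polynomial `q` of degree at most `n + j − 1`. -/
theorem stmt4 (L : Polynomial ℂ →ₗ[ℂ] ℂ) (m : ℕ → ℂ) (hm : ∀ i, m i = L (X ^ i))
    (n j : ℕ) (hj : 1 ≤ j)
    (hΔ : hankelDet m n ≠ 0)
    (hzeros : ∀ i < j, hankelDet m (n + 1 + i) = 0)
    (π : Polynomial ℂ) (hmonic : π.Monic) (hdeg : π.natDegree = n)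
    (hFOP : ∀ i < n, L (π * X ^ i) = 0) :
    ∀ q : Polynomial ℂ, q.degree < ((n + j : ℕ) : WithBot ℕ) → L (π * q) = 0 := by
  have key : ∀ k ≤ j, ∀ i < n + k, L (π * X ^ i) = 0 := by
    intro k
    induction k with
    | zero => intro _; simpa using hFOP
    | succ k ih =>
      intro hk
      have ih' := ih (by omega)
      have orth := aux_orth L π (n + k) ih'
      obtain ⟨p, hp, hpd, hpo⟩ := (aux_sing L m hm _).1 (hzeros k (by omega))
      have hdiv := modByMonic_add_div p π
      set r := p %ₘ π with hr
      set q := p /ₘ π with hq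
      have hrd : r.degree < (n : WithBot ℕ) := by
        have := degree_modByMonic_lt p hmonic
        rwa [degree_eq_natDegree hmonic.ne_zero, hdeg] at this
      have hqd : q.natDegree ≤ k := by
        rw [hq, natDegree_divByMonic p hmonic, hdeg]
        have : p.natDegree < n + 1 + k := (natDegree_lt_iff_degree_lt hp).2 hpd
        omega
      have hr0 : r = 0 := by
        by_contra hne
        apply hΔ
        refine (aux_sing L m hm n).2 ⟨r, hne, hrd, fun i hi => ?_⟩
        have h1 : r * X ^ i = p * X ^ i - π * (q * X ^ i) := by
          rw [← hdiv]; ring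
        rw [h1, map_sub, hpo i (by omega), orth, sub_zero]
        refine lt_of_le_of_lt degree_le_natDegree ?_
        have : (q * X ^ i).natDegree ≤ k + i := natDegree_mul_le_of_le hqd (natDegree_X_pow_le i)
        exact_mod_cast (by omega : (q * X ^ i).natDegree < n + k)
      have hq0 : q ≠ 0 := by
        rintro h0
        rw [hr0, h0] at hdiv
        simp at hdiv
        exact hp hdiv.symm
      intro i hi
      rcases Nat.lt_or_ge i (n + k) with h | h
      · exact ih' i h
      have hik : i = n + k := by omega
      subst hik
      set e := n + k - q.natDegree with he
      have h2 := hpo e (by omega)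
      have h3 : p * X ^ e = π * (q.eraseLead * X ^ e) + q.leadingCoeff • (π * X ^ (n + k)) := by
        have h4 : n + k = q.natDegree + e := by omega
        rw [h4, smul_eq_C_mul, pow_add]
        conv_lhs => rw [← hdiv, hr0, ← eraseLead_add_C_mul_X_pow q]
        ring
      have h5 : L (π * (q.eraseLead * X ^ e)) = 0 := by
        apply orth
        by_cases h0 : q.eraseLead = 0
        · rw [h0, zero_mul, degree_zero]; exact WithBot.bot_lt_coe _
        have h6 := (natDegree_lt_natDegree h0 (degree_eraseLead_lt hq0))
        have : (q.eraseLead * X ^ e).natDegree ≤ q.eraseLead.natDegree + e :=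
          natDegree_mul_le_of_le le_rfl (natDegree_X_pow_le e)
        refine lt_of_le_of_lt degree_le_natDegree ?_
        exact_mod_cast (by omega : (q.eraseLead * X ^ e).natDegree < n + k)
      rw [h3, map_add, h5, zero_add, map_smul, smul_eq_mul] at h2
      exact (mul_eq_zero.1 h2).resolve_left (leadingCoeff_ne_zero.2 hq0)
  exact fun q hq => aux_orth L π (n + j) (key j le_rfl) q hq
end

section
/- Assume Δ_{k−1} ≠ 0 and Δ_{k−1+i} = 0 for i = 1,…,j, and let π_k be the unique monic formal orthogonal polynomial of degree k with respect to L. Then for each i with 1 ≤ i ≤ j, a monic polynomial of degree k+i is quasi-orthogonal of order i with respect to L if and only if it has the form π_k(λ)·∏_{t=1}^{i}(λ − η_t) for some η_1,…,η_i ∈ ℂ (equivalently, if and only if it is divisible by π_k). -/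
open Polynomial Matrix

theorem aux_expand (L : Polynomial ℂ →ₗ[ℂ] ℂ) (f q : Polynomial ℂ) (n t : ℕ)
    (hn : q.natDegree < n) :
    L (f * q * X ^ t) = ∑ a ∈ Finset.range n, q.coeff a * L (f * X ^ (a + t)) := by
  conv_lhs => rw [q.as_sum_range_C_mul_X_pow' hn]
  rw [Finset.mul_sum, Finset.sum_mul, map_sum]
  refine Finset.sum_congr rfl fun a _ => ?_
  have : f * (C (q.coeff a) * X ^ a) * X ^ t = q.coeff a • (f * X ^ (a + t)) := by
    rw [smul_eq_C_mul]; ring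
  rw [this, map_smul, smul_eq_mul]

theorem aux_row (L : Polynomial ℂ →ₗ[ℂ] ℂ) (m : ℕ → ℂ) (hm : ∀ i, m i = L (X ^ i))
    (n t : ℕ) (r : Polynomial ℂ) (hr : r.natDegree < n) :
    L (r * X ^ t) = ∑ a : Fin n, m (t + a) * r.coeff a := by
  have := aux_expand L 1 r n t hr
  rw [one_mul] at this
  rw [this, Finset.sum_range]
  refine Finset.sum_congr rfl fun a _ => ?_
  rw [hm, one_mul, mul_comm, add_comm]

theorem aux_nonzero (L : Polynomial ℂ →ₗ[ℂ] ℂ) (m : ℕ → ℂ) (hm : ∀ i, m i = L (X ^ i))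
    (n : ℕ) (hΔ : hankelDet m n ≠ 0) (r : Polynomial ℂ) (hr : r.natDegree < n)
    (h : ∀ t < n, L (r * X ^ t) = 0) : r = 0 := by
  by_contra hne
  apply hΔ
  unfold hankelDet
  rw [← Matrix.exists_mulVec_eq_zero_iff]
  refine ⟨fun a => r.coeff a, fun h0 => hne ?_, ?_⟩
  · have := congrFun h0 ⟨r.natDegree, hr⟩
    simpa using this
  · ext t
    have h1 := h t t.2
    rw [aux_row L m hm n t r hr] at h1
    simpa [Matrix.mulVec, dotProduct] using h1

theorem aux_zero (L : Polynomial ℂ →ₗ[ℂ] ℂ) (m : ℕ → ℂ) (hm : ∀ i, m i = L (X ^ i))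
    (n : ℕ) (hn : 0 < n) (hΔ : hankelDet m n = 0) :
    ∃ v : Polynomial ℂ, v ≠ 0 ∧ v.natDegree < n ∧ ∀ t < n, L (v * X ^ t) = 0 := by
  unfold hankelDet at hΔ
  rw [← Matrix.exists_mulVec_eq_zero_iff] at hΔ
  obtain ⟨w, hw, h⟩ := hΔ
  have hc : ∀ a : Fin n, (∑ b : Fin n, C (w b) * X ^ (b : ℕ) : Polynomial ℂ).coeff a = w a := by
    intro a
    simp [Polynomial.finset_sum_coeff, coeff_C_mul, coeff_X_pow, Fin.val_inj]
  have hd : (∑ b : Fin n, C (w b) * X ^ (b : ℕ) : Polynomial ℂ).natDegree < n := by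
    have : (∑ b : Fin n, C (w b) * X ^ (b : ℕ) : Polynomial ℂ).natDegree ≤ n - 1 := by
      apply natDegree_sum_le_of_forall_le
      intro b _
      refine (natDegree_C_mul_X_pow_le _ _).trans ?_
      have := b.2
      omega
    omega
  refine ⟨_, fun h0 => hw ?_, hd, fun t ht => ?_⟩
  · ext a
    rw [← hc a, h0]; simp
  · rw [aux_row L m hm n t _ hd]
    simp only [hc]
    have := congrFun h ⟨t, ht⟩
    simpa [Matrix.mulVec, dotProduct] using this

theorem aux_split (π p : Polynomial ℂ) (hmonic : π.Monic) (k : ℕ) (hk : 1 ≤ k)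
    (hdeg : π.natDegree = k) :
    (p %ₘ π).natDegree < k ∧ (p /ₘ π).natDegree = p.natDegree - k ∧
      p = p %ₘ π + π * (p /ₘ π) := by
  refine ⟨?_, ?_, (modByMonic_add_div p π).symm⟩
  · rw [← hdeg]
    apply natDegree_modByMonic_lt p hmonic
    rintro rfl
    simp at hdeg
    omega
  · rw [natDegree_divByMonic p hmonic, hdeg]

theorem aux_mul_zero (L : Polynomial ℂ →ₗ[ℂ] ℂ) (π q : Polynomial ℂ) (N t : ℕ)
    (h : ∀ s < N, L (π * X ^ s) = 0) (hq : q.natDegree + t < N) :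
    L (π * q * X ^ t) = 0 := by
  rw [aux_expand L π q _ t (Nat.lt_succ_self _)]
  refine Finset.sum_eq_zero fun a ha => ?_
  rw [Finset.mem_range] at ha
  rw [h _ (by omega), mul_zero]

theorem aux_orth_s5 (L : Polynomial ℂ →ₗ[ℂ] ℂ) (m : ℕ → ℂ) (hm : ∀ i, m i = L (X ^ i))
    (k j : ℕ) (hk : 1 ≤ k)
    (hΔ : hankelDet m k ≠ 0)
    (hzeros : ∀ i, 1 ≤ i → i ≤ j → hankelDet m (k + i) = 0)
    (π : Polynomial ℂ) (hmonic : π.Monic) (hdeg : π.natDegree = k)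
    (hFOP : ∀ t < k, L (π * X ^ t) = 0) :
    ∀ i ≤ j, ∀ s < k + i, L (π * X ^ s) = 0 := by
  intro i
  induction i with
  | zero => intro _; exact hFOP
  | succ i ih =>
    intro hi
    have ih := ih (by omega)
    suffices hc : L (π * X ^ (k + i)) = 0 by
      intro s hs
      rcases Nat.lt_or_ge s (k + i) with h | h
      · exact ih s h
      · obtain rfl : s = k + i := by omega
        exact hc
    obtain ⟨v, hv, hvd, hvL⟩ := aux_zero L m hm _ (by omega) (hzeros (i + 1) (by omega) hi)
    obtain ⟨h1, h2, h3⟩ := aux_split π v hmonic k hk hdeg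
    have hr : v %ₘ π = 0 := by
      apply aux_nonzero L m hm k hΔ _ h1
      intro t ht
      have h4 := hvL t (by omega)
      rw [h3, add_mul, map_add, aux_mul_zero L π _ (k + i) t ih (by omega), add_zero] at h4
      exact h4
    rw [hr, zero_add] at h3
    generalize v /ₘ π = q at h2 h3
    have hq : q ≠ 0 := by
      rintro rfl
      exact hv (by simpa using h3)
    have h5 := hvL (k + i - q.natDegree) (by omega)
    rw [h3, aux_expand L π q _ _ (Nat.lt_succ_self _), Finset.sum_range_succ,
      Finset.sum_eq_zero, zero_add] at h5
    · rw [show q.natDegree + (k + i - q.natDegree) = k + i by omega] at h5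
      rcases mul_eq_zero.1 h5 with h | h
      · exact absurd (leadingCoeff_eq_zero.1 h) hq
      · exact h
    · intro a ha
      rw [Finset.mem_range] at ha
      rw [ih _ (by omega), mul_zero]

/-- Assume `Δ_{k−1} ≠ 0` and `Δ_{k−1+i} = 0` for `i = 1, …, j`, and let
`π_k` be the unique monic FOP of degree `k`. Then for `1 ≤ i ≤ j`, a monic polynomial of
degree `k + i` is quasi-orthogonal of order `i` (i.e. `L (p λ^t) = 0` for
`t = 0, …, k − 1`) iff it is divisible by `π_k` (equivalently, iff it has the form
`π_k(λ)·∏_{t=1}^{i}(λ − η_t)`). -/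
theorem stmt5 (L : Polynomial ℂ →ₗ[ℂ] ℂ) (m : ℕ → ℂ) (hm : ∀ i, m i = L (X ^ i))
    (k j : ℕ) (hk : 1 ≤ k)
    (hΔ : hankelDet m k ≠ 0)
    (hzeros : ∀ i, 1 ≤ i → i ≤ j → hankelDet m (k + i) = 0)
    (π : Polynomial ℂ) (hmonic : π.Monic) (hdeg : π.natDegree = k)
    (hFOP : ∀ t < k, L (π * X ^ t) = 0) :
    ∀ i, 1 ≤ i → i ≤ j → ∀ p : Polynomial ℂ, p.Monic → p.natDegree = k + i →
      ((∀ t < k, L (p * X ^ t) = 0) ↔ π ∣ p) := by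
  intro i hi hij p _ hpd
  have ho := aux_orth_s5 L m hm k j hk hΔ hzeros π hmonic hdeg hFOP i hij
  obtain ⟨h1, h2, h3⟩ := aux_split π p hmonic k hk hdeg
  have hz : ∀ t < k, L (p * X ^ t) = L ((p %ₘ π) * X ^ t) := by
    intro t ht
    by_cases hlt : (p /ₘ π).natDegree + t < k + i
    · conv_lhs => rw [h3]
      rw [add_mul, map_add, aux_mul_zero L π _ (k + i) t ho hlt, add_zero]
    · omega
  rw [← modByMonic_eq_zero_iff_dvd hmonic]
  constructor
  · intro h
    exact aux_nonzero L m hm k hΔ _ h1 fun t ht => by rw [← hz t ht]; exact h t ht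
  · intro h t ht
    rw [hz t ht, h, zero_mul, map_zero]
end

section
/- Let p_n be a polynomial of degree n with distinct roots λ_1,…,λ_ℓ of multiplicities s_1,…,s_ℓ (so s_1+⋯+s_ℓ = n), and let G_n be the interpolatory quadrature determined by p_n, i.e. the quadrature with these nodes and multiplicities whose weights are ω_{i,j} = L(h_{i,j}). Then for 0 ≤ k ≤ n, G_n is exact for all polynomials of degree at most n+k−1 (that is, G_n(q) = L(q) for all q ∈ 𝒫_{n+k−1}) if and only if p_n is quasi-orthogonal of order n−k with respect to L (that is, L(p_n λ^j) = 0 for j = 0,…,k−1). -/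
open Polynomial Matrix

theorem aux_local (q : Polynomial ℂ) (a : ℂ) (m : ℕ) :
    (X - C a) ^ m ∣ q ↔ ∀ t < m, (Polynomial.derivative^[t] q).eval a = 0 := by
  by_cases hq : q = 0
  · subst hq
    simp
  · rw [← le_rootMultiplicity_iff hq]
    cases m with
    | zero => simp
    | succ m =>
      rw [Nat.succ_le_iff, lt_rootMultiplicity_iff_isRoot_iterate_derivative hq]
      exact ⟨fun H t ht => H t (by omega), fun H t ht => H t (by omega)⟩

theorem aux_dvd (ℓ : ℕ) (node : Fin ℓ → ℂ) (s : Fin ℓ → ℕ)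
    (hinj : Function.Injective node) (c : ℂ) (hc : c ≠ 0) (q : Polynomial ℂ) :
    (C c * ∏ i, (X - C (node i)) ^ s i) ∣ q ↔
      ∀ i, ∀ t < s i, (Polynomial.derivative^[t] q).eval (node i) = 0 := by
  rw [C_mul_dvd hc]
  constructor
  · intro H i
    have h1 : (X - C (node i)) ^ s i ∣ ∏ i, (X - C (node i)) ^ s i :=
      Finset.dvd_prod_of_mem (fun i => (X - C (node i)) ^ s i) (Finset.mem_univ i)
    exact (aux_local q (node i) (s i)).1 (h1.trans H)
  · intro H
    refine Finset.prod_dvd_of_coprime ?_ (fun i _ => (aux_local q (node i) (s i)).2 (H i))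
    intro i _ j _ hij
    exact (pairwise_coprime_X_sub_C hinj hij).pow

/-- Let `p_n` be a degree-`n` polynomial with distinct roots
`λ_1, …, λ_ℓ` of multiplicities `s_1, …, s_ℓ` (so `s_1 + ⋯ + s_ℓ = n`), and let `G_n` be
the interpolatory quadrature determined by `p_n` (weights `ω_{i,j} = L(h_{i,j})`). Then
for `0 ≤ k ≤ n`, `G_n` is exact on polynomials of degree at most `n + k − 1` iff `p_n`
is quasi-orthogonal of order `n − k`, i.e. `L(p_n λ^t) = 0` for `t = 0, …, k − 1`. -/
theorem stmt8 (L : Polynomial ℂ →ₗ[ℂ] ℂ)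
    (ℓ n : ℕ) (node : Fin ℓ → ℂ) (s : Fin ℓ → ℕ)
    (hinj : Function.Injective node) (hs : ∀ i, 1 ≤ s i) (hsum : ∑ i, s i = n)
    (c : ℂ) (hc : c ≠ 0)
    (p : Polynomial ℂ) (hp : p = C c * ∏ i, (X - C (node i)) ^ s i)
    (h : Fin ℓ → ℕ → Polynomial ℂ)
    (hhdeg : ∀ (i : Fin ℓ) (j : ℕ), j < s i → (h i j).degree < (n : WithBot ℕ))
    (hherm : ∀ (i : Fin ℓ) (j : ℕ), j < s i → ∀ (r : Fin ℓ) (t : ℕ), t < s r →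
      (Polynomial.derivative^[t] (h i j)).eval (node r) = if r = i ∧ t = j then 1 else 0)
    (ω : Fin ℓ → ℕ → ℂ)
    (hω : ∀ (i : Fin ℓ) (j : ℕ), j < s i → ω i j = L (h i j))
    (k : ℕ) (hkn : k ≤ n) :
    (∀ q : Polynomial ℂ, q.degree < ((n + k : ℕ) : WithBot ℕ) →
        L q = ∑ i, ∑ j ∈ Finset.range (s i),
          ω i j * (Polynomial.derivative^[j] q).eval (node i)) ↔
      (∀ t < k, L (p * X ^ t) = 0) := by
  have hdvd : ∀ q : Polynomial ℂ, p ∣ q ↔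
      ∀ i, ∀ t < s i, (Polynomial.derivative^[t] q).eval (node i) = 0 := by
    intro q
    rw [hp]
    exact aux_dvd ℓ node s hinj c hc q
  have hpdeg : p.degree = (n : WithBot ℕ) := by
    rw [hp, degree_C_mul hc, degree_prod, ← hsum]
    simp
  have hp0 : p ≠ 0 := by
    rintro rfl
    simp at hpdeg
  have hlow : ∀ q : Polynomial ℂ, q.degree < (n : WithBot ℕ) →
      L q = ∑ i, ∑ j ∈ Finset.range (s i),
          ω i j * (Polynomial.derivative^[j] q).eval (node i) := by
    intro q hq
    have key : q - ∑ i, ∑ j ∈ Finset.range (s i),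
        C ((Polynomial.derivative^[j] q).eval (node i)) * h i j = 0 := by
      refine eq_zero_of_dvd_of_degree_lt (p := p) ((hdvd _).2 ?_) ?_
      · intro r t ht
        rw [iterate_derivative_sub, iterate_derivative_sum, eval_sub, eval_finsetSum,
          Finset.sum_eq_single r]
        · rw [iterate_derivative_sum, eval_finsetSum, Finset.sum_eq_single t]
          · rw [iterate_derivative_C_mul, eval_C_mul, hherm r t ht r t ht]
            simp
          · intro j hj hjt
            rw [iterate_derivative_C_mul, eval_C_mul, hherm r j (Finset.mem_range.1 hj) r t ht,
              if_neg (fun hh => hjt hh.2.symm), mul_zero]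
          · intro hh
            exact absurd (Finset.mem_range.2 ht) hh
        · intro i _ hir
          rw [iterate_derivative_sum, eval_finsetSum]
          refine Finset.sum_eq_zero fun j hj => ?_
          rw [iterate_derivative_C_mul, eval_C_mul, hherm i j (Finset.mem_range.1 hj) r t ht,
              if_neg (fun hh => hir hh.1.symm), mul_zero]
        · simp
      · rw [hpdeg, ← mem_degreeLT]
        refine Submodule.sub_mem _ (mem_degreeLT.2 hq) (Submodule.sum_mem _ fun i _ =>
          Submodule.sum_mem _ fun j hj => ?_)
        rw [← smul_eq_C_mul]
        exact Submodule.smul_mem _ _ (mem_degreeLT.2 (hhdeg i j (Finset.mem_range.1 hj)))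
    conv_lhs => rw [sub_eq_zero.1 key]
    rw [map_sum]
    refine Finset.sum_congr rfl fun i _ => ?_
    rw [map_sum]
    refine Finset.sum_congr rfl fun j hj => ?_
    rw [← smul_eq_C_mul, map_smul, hω i j (Finset.mem_range.1 hj), smul_eq_mul, mul_comm]
  constructor
  · intro H t ht
    rw [H]
    · refine Finset.sum_eq_zero fun i _ => Finset.sum_eq_zero fun j hj => ?_
      rw [(hdvd (p * X ^ t)).1 (dvd_mul_right _ _) i j (Finset.mem_range.1 hj), mul_zero]
    · rw [degree_mul, hpdeg, degree_X_pow]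
      exact_mod_cast Nat.add_lt_add_left ht n
  · intro H q hq
    have hdm : p * (q / p) + q % p = q := EuclideanDomain.div_add_mod q p
    have hquo : L (p * (q / p)) = 0 := by
      by_cases hr : q / p = 0
      · rw [hr, mul_zero, map_zero]
      have hle : p.degree ≤ q.degree := by
        by_contra hlt
        exact hr ((Polynomial.div_eq_zero_iff hp0).2 (not_le.1 hlt))
      have hadd := degree_add_div hp0 hle
      have hdeg : (q / p).natDegree < k := by
        rw [← hadd, hpdeg, degree_eq_natDegree hr] at hq
        have : n + (q / p).natDegree < n + k := by exact_mod_cast hq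
        omega
      rw [as_sum_range_C_mul_X_pow' (q / p) hdeg, Finset.mul_sum, map_sum]
      refine Finset.sum_eq_zero fun t ht => ?_
      rw [mul_left_comm, ← smul_eq_C_mul, map_smul, H t (Finset.mem_range.1 ht), smul_zero]
    have hrem : L (q % p) = _ := hlow (q % p) (hpdeg ▸ degree_mod_lt q hp0)
    conv_lhs => rw [← hdm]
    rw [map_add, hquo, zero_add, hrem]
    refine Finset.sum_congr rfl fun i _ => Finset.sum_congr rfl fun j hj => ?_
    congr 1
    conv_rhs => rw [← hdm]
    rw [iterate_map_add, eval_add,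
      (hdvd (p * (q / p))).1 (dvd_mul_right _ _) i j (Finset.mem_range.1 hj), zero_add]
end

section
/- Let n ≥ 1, assume Δ_{n−1} ≠ 0, and let p_n be the unique (up to a nonzero scalar) formal orthogonal polynomial of degree n with respect to L, with distinct roots λ_1,…,λ_ℓ of multiplicities s_1,…,s_ℓ. Then the weights of the interpolatory quadrature determined by p_n satisfy ω_{i,s_i−1} = L(h_{i,s_i−1}) ≠ 0 for every i = 1,…,ℓ. -/
open Polynomial Matrix

/-- Let `n ≥ 1`, `Δ_{n−1} ≠ 0`, and let `p_n` be the formal orthogonal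
polynomial of degree `n` w.r.t. `L`, with distinct roots `λ_1, …, λ_ℓ` of multiplicities
`s_1, …, s_ℓ`. Then the weights of the interpolatory quadrature determined by `p_n`
satisfy `ω_{i, s_i − 1} = L(h_{i, s_i − 1}) ≠ 0` for every `i`. -/
theorem stmt9 (L : Polynomial ℂ →ₗ[ℂ] ℂ) (m : ℕ → ℂ) (hm : ∀ i, m i = L (X ^ i))
    (n : ℕ) (hn : 1 ≤ n) (hΔ : hankelDet m n ≠ 0)
    (ℓ : ℕ) (node : Fin ℓ → ℂ) (s : Fin ℓ → ℕ)
    (hinj : Function.Injective node) (hs : ∀ i, 1 ≤ s i) (hsum : ∑ i, s i = n)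
    (c : ℂ) (hc : c ≠ 0)
    (p : Polynomial ℂ) (hp : p = C c * ∏ i, (X - C (node i)) ^ s i)
    (hFOP : ∀ t < n, L (p * X ^ t) = 0)
    (h : Fin ℓ → ℕ → Polynomial ℂ)
    (hhdeg : ∀ (i : Fin ℓ) (j : ℕ), j < s i → (h i j).degree < (n : WithBot ℕ))
    (hherm : ∀ (i : Fin ℓ) (j : ℕ), j < s i → ∀ (r : Fin ℓ) (t : ℕ), t < s r →
      (Polynomial.derivative^[t] (h i j)).eval (node r) = if r = i ∧ t = j then 1 else 0) :
    ∀ i : Fin ℓ, L (h i (s i - 1)) ≠ 0 := by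
  intro i hL
  set g := h i (s i - 1) with hg
  have hsi := hs i
  have hH := hherm i (s i - 1) (by omega)
  have hdeg := hhdeg i (s i - 1) (by omega)
  rw [← hg] at hH hdeg
  have hg0 : g ≠ 0 := by
    intro h0
    have := hH i (s i - 1) (by omega)
    rw [h0] at this
    simp at this
  have hX : (X - C (node i)) ≠ 0 := X_sub_C_ne_zero _
  have key : ∀ (r : Fin ℓ) (k : ℕ), (∀ t < k, (derivative^[t] g).eval (node r) = 0) →
      (X - C (node r)) ^ k ∣ g := by
    intro r k hk
    rw [← le_rootMultiplicity_iff hg0]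
    cases k with
    | zero => simp
    | succ k =>
      apply (lt_rootMultiplicity_iff_isRoot_iterate_derivative hg0).2
      intro t ht
      exact hk t (by omega)
  have hdvd : ∀ r, (X - C (node r)) ^ s r ∣ (X - C (node i)) * g := by
    intro r
    by_cases hr : r = i
    · subst hr
      have h1 := key r (s r - 1) (by
        intro t ht
        rw [hH r t (by omega), if_neg (by omega)])
      have h2 := mul_dvd_mul_left (X - C (node r)) h1
      rwa [← pow_succ', Nat.sub_add_cancel hsi] at h2
    · refine Dvd.dvd.mul_left (key r (s r) ?_) _
      intro t ht
      rw [hH r t ht, if_neg (by tauto)]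
  have hprod : (∏ r, (X - C (node r)) ^ s r) ∣ (X - C (node i)) * g := by
    apply Finset.prod_dvd_of_coprime
    · intro a _ b _ hab
      exact ((pairwise_coprime_X_sub_C hinj) hab).pow
    · intro r _
      exact hdvd r
  obtain ⟨q, hq⟩ := hprod
  have hmon : (∏ r, (X - C (node r)) ^ s r).Monic :=
    monic_prod_of_monic _ _ fun r _ => (monic_X_sub_C _).pow _
  have hnat : (∏ r, (X - C (node r)) ^ s r).natDegree = n := by
    rw [natDegree_prod_of_monic _ _ fun r _ => (monic_X_sub_C _).pow _]
    simp [hsum]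
  have hgn : g.natDegree < n := (natDegree_lt_iff_degree_lt hg0).2 hdeg
  have hq0 : q ≠ 0 := by
    rintro rfl
    rw [mul_zero] at hq
    exact mul_ne_zero hX hg0 hq
  have hqd : q.natDegree = 0 := by
    have := congrArg natDegree hq
    rw [natDegree_mul hX hg0, hmon.natDegree_mul' hq0, hnat, natDegree_X_sub_C] at this
    omega
  obtain ⟨d, rfl⟩ := natDegree_eq_zero.1 hqd
  have hgp : (X - C (node i)) * g = (d * c⁻¹) • p := by
    rw [hq, hp, smul_eq_C_mul, ← mul_assoc, ← C_mul, mul_assoc, inv_mul_cancel₀ hc, mul_one,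
      mul_comm]
  have hz : ∀ t < n, L (g * X ^ t) = 0 := by
    intro t
    induction t with
    | zero => intro _; simpa using hL
    | succ t ih =>
      intro ht
      have e : g * X ^ (t + 1) = (d * c⁻¹) • (p * X ^ t) + node i • (g * X ^ t) := by
        rw [← smul_mul_assoc, ← hgp, smul_eq_C_mul]
        ring
      rw [e, map_add, map_smul, map_smul, hFOP t (by omega), ih (by omega)]
      simp
  have hv : (Matrix.of fun i j : Fin n => m ((i : ℕ) + (j : ℕ))) *ᵥ
      (fun j : Fin n => g.coeff j) = 0 := by
    funext a
    have h1 := hz a a.2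
    rw [g.as_sum_range' n hgn, Finset.sum_mul, map_sum, Finset.sum_range] at h1
    rw [Pi.zero_apply, ← h1]
    simp only [Matrix.mulVec, dotProduct, Matrix.of_apply]
    refine Finset.sum_congr rfl fun j _ => ?_
    rw [hm, ← C_mul_X_pow_eq_monomial, mul_assoc, ← pow_add, ← smul_eq_C_mul, map_smul,
      smul_eq_mul, mul_comm, add_comm]
  have hv0 := Matrix.eq_zero_of_mulVec_eq_zero hΔ hv
  apply hg0
  ext k
  by_cases hk : k < n
  · exact congrFun hv0 ⟨k, hk⟩
  · rw [coeff_zero]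
    exact coeff_eq_zero_of_natDegree_lt (by omega)
end

section
/- For n ≥ 1, there exists an n-node Gauss quadrature for L (i.e. distinct nodes λ_1,…,λ_ℓ ∈ ℂ, multiplicities s_1,…,s_ℓ with s_1+⋯+s_ℓ = n, and weights ω_{i,j} with ω_{i,s_i−1} ≠ 0 for all i, such that L(q) = Σ_{i=1}^{ℓ} Σ_{j=0}^{s_i−1} ω_{i,j} q^{(j)}(λ_i) for every polynomial q of degree at most 2n−1) if and only if Δ_{n−1} ≠ 0; moreover, when it exists, the n-node Gauss quadrature is unique (its nodes, multiplicities, and weights are uniquely determined up to reordering of the nodes). -/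
open Polynomial Matrix

/-- An `n`-node Gauss quadrature for the linear functional `L`: distinct nodes with
multiplicities summing to `n`, weights with nonzero top weight at each node, exact on
all polynomials of degree at most `2n − 1`. -/
structure GaussQuadrature (L : Polynomial ℂ →ₗ[ℂ] ℂ) (n : ℕ) where
  len : ℕ
  node : Fin len → ℂ
  mult : Fin len → ℕ
  weight : Fin len → ℕ → ℂ
  node_inj : Function.Injective node
  mult_pos : ∀ i, 1 ≤ mult i
  sum_mult : ∑ i, mult i = n
  top_weight_ne : ∀ i, weight i (mult i - 1) ≠ 0
  exactness : ∀ q : Polynomial ℂ, q.degree < ((2 * n : ℕ) : WithBot ℕ) →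
    L q = ∑ i, ∑ j ∈ Finset.range (mult i),
      weight i j * (Polynomial.derivative^[j] q).eval (node i)

/-- The quadrature functional. -/
noncomputable def quadG {l : ℕ} (node : Fin l → ℂ) (mult : Fin l → ℕ) (w : Fin l → ℕ → ℂ)
    (q : Polynomial ℂ) : ℂ :=
  ∑ i, ∑ j ∈ Finset.range (mult i), w i j * (Polynomial.derivative^[j] q).eval (node i)

/-- The node polynomial. -/
noncomputable def nodalP {l : ℕ} (node : Fin l → ℂ) (mult : Fin l → ℕ) : Polynomial ℂ :=
  ∏ i, (X - C (node i)) ^ mult i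

/-- The node polynomial with one node removed. -/
noncomputable def cofP {l : ℕ} (node : Fin l → ℂ) (mult : Fin l → ℕ) (i : Fin l) :
    Polynomial ℂ :=
  ∏ k ∈ Finset.univ.erase i, (X - C (node k)) ^ mult k

lemma nodalP_eq {l : ℕ} (node : Fin l → ℂ) (mult : Fin l → ℕ) (i : Fin l) :
    nodalP node mult = (X - C (node i)) ^ mult i * cofP node mult i :=
  (Finset.mul_prod_erase _ _ (Finset.mem_univ i)).symm

lemma nodalP_monic {l : ℕ} (node : Fin l → ℂ) (mult : Fin l → ℕ) :
    (nodalP node mult).Monic :=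
  monic_prod_of_monic _ _ fun i _ => (monic_X_sub_C _).pow _

lemma cofP_monic {l : ℕ} (node : Fin l → ℂ) (mult : Fin l → ℕ) (i : Fin l) :
    (cofP node mult i).Monic :=
  monic_prod_of_monic _ _ fun i _ => (monic_X_sub_C _).pow _

lemma nodalP_natDegree {l : ℕ} (node : Fin l → ℂ) (mult : Fin l → ℕ) :
    (nodalP node mult).natDegree = ∑ i, mult i := by
  unfold nodalP
  rw [natDegree_prod_of_monic _ _ fun i _ => (monic_X_sub_C _).pow _]
  simp

lemma cofP_natDegree {l : ℕ} (node : Fin l → ℂ) (mult : Fin l → ℕ) (i : Fin l) :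
    mult i + (cofP node mult i).natDegree = ∑ i, mult i := by
  rw [← nodalP_natDegree node mult, nodalP_eq node mult i,
    ((monic_X_sub_C _).pow _).natDegree_mul (cofP_monic _ _ _)]
  simp

lemma cofP_eval_ne {l : ℕ} {node : Fin l → ℂ} (hi : Function.Injective node) (mult : Fin l → ℕ)
    (i : Fin l) : (cofP node mult i).eval (node i) ≠ 0 := by
  unfold cofP
  rw [eval_prod, Finset.prod_ne_zero_iff]
  intro k hk
  simp only [eval_pow, eval_sub, eval_X, eval_C]
  apply pow_ne_zero
  rw [sub_ne_zero]
  intro h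
  exact (Finset.ne_of_mem_erase hk) (hi h).symm

lemma cofP_dvd {l : ℕ} (node : Fin l → ℂ) (mult : Fin l → ℕ) {i k : Fin l} (h : k ≠ i) :
    (X - C (node k)) ^ mult k ∣ cofP node mult i :=
  Finset.dvd_prod_of_mem (fun k => (X - C (node k)) ^ mult k) (by simp [h])

lemma eval_deriv_zero {a : ℂ} {s j : ℕ} {q : Polynomial ℂ} (h : (X - C a) ^ s ∣ q) (hj : j < s) :
    (derivative^[j] q).eval a = 0 := by
  by_cases hq : q = 0
  · simp [hq]
  · exact isRoot_iterate_derivative_of_lt_rootMultiplicity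
      (lt_of_lt_of_le hj ((le_rootMultiplicity_iff hq).2 h))

lemma dvd_of_eval_deriv {a : ℂ} {s : ℕ} {q : Polynomial ℂ}
    (h : ∀ j < s, (derivative^[j] q).eval a = 0) : (X - C a) ^ s ∣ q := by
  by_cases hq : q = 0
  · simp [hq]
  · cases s with
    | zero => simp
    | succ s =>
      rw [← le_rootMultiplicity_iff hq]
      exact (lt_rootMultiplicity_iff_isRoot_iterate_derivative hq).2
        fun m hm => h m (Nat.lt_succ_of_le hm)

lemma rootMult_mul {a : ℂ} {k : ℕ} {r : Polynomial ℂ} (h : r.eval a ≠ 0) :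
    ((X - C a) ^ k * r).rootMultiplicity a = k := by
  have hr : r ≠ 0 := by rintro rfl; simp at h
  rw [rootMultiplicity_mul (mul_ne_zero (pow_ne_zero _ (X_sub_C_ne_zero a)) hr),
    rootMultiplicity_X_sub_C_pow, rootMultiplicity_eq_zero h, add_zero]

lemma eval_deriv_ne {a : ℂ} {k : ℕ} {r : Polynomial ℂ} (h : r.eval a ≠ 0) :
    (derivative^[k] ((X - C a) ^ k * r)).eval a ≠ 0 := by
  intro h0
  have hr : r ≠ 0 := by rintro rfl; simp at h
  have := (lt_rootMultiplicity_iff_isRoot_iterate_derivative (t := a) (n := k)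
    (mul_ne_zero (pow_ne_zero k (X_sub_C_ne_zero a)) hr)).2 (by
      intro m hm
      rcases hm.lt_or_eq with hm | rfl
      · exact eval_deriv_zero (dvd_mul_right _ _) hm
      · exact h0)
  rw [rootMult_mul h] at this
  exact lt_irrefl _ this

lemma quadG_zero {l : ℕ} {node : Fin l → ℂ} {mult : Fin l → ℕ} {w : Fin l → ℕ → ℂ}
    {q : Polynomial ℂ} (h : nodalP node mult ∣ q) : quadG node mult w q = 0 := by
  refine Finset.sum_eq_zero fun i _ => Finset.sum_eq_zero fun j hj => ?_
  rw [eval_deriv_zero (s := mult i) _ (Finset.mem_range.1 hj), mul_zero]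
  exact (Finset.dvd_prod_of_mem (fun k => (X - C (node k)) ^ mult k) (Finset.mem_univ i)).trans h

lemma quadG_key {l : ℕ} {node : Fin l → ℂ} {mult : Fin l → ℕ} {w : Fin l → ℕ → ℂ}
    {i : Fin l} {k : ℕ} (hk : k < mult i) (hw : ∀ j, k < j → j < mult i → w i j = 0)
    (r : Polynomial ℂ) :
    quadG node mult w ((X - C (node i)) ^ k * (cofP node mult i * r)) =
      w i k * (derivative^[k] ((X - C (node i)) ^ k * (cofP node mult i * r))).eval (node i) := by
  unfold quadG
  rw [Finset.sum_eq_single i]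
  · rw [Finset.sum_eq_single k]
    · intro j hj hjk
      rcases lt_or_gt_of_ne hjk with h | h
      · rw [eval_deriv_zero (dvd_mul_right _ _) h, mul_zero]
      · rw [hw j h (Finset.mem_range.1 hj), zero_mul]
    · intro h; exact absurd (Finset.mem_range.2 hk) h
  · intro i' _ hne
    refine Finset.sum_eq_zero fun j hj => ?_
    rw [eval_deriv_zero (s := mult i') _ (Finset.mem_range.1 hj), mul_zero]
    exact ((cofP_dvd node mult hne).mul_right r).mul_left _
  · intro h; exact absurd (Finset.mem_univ i) h

lemma deg_aux {l : ℕ} (node : Fin l → ℂ) (mult : Fin l → ℕ) (i : Fin l) {k : ℕ}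
    (hk : k < mult i) :
    ((X - C (node i)) ^ k * cofP node mult i).degree < ((∑ i, mult i : ℕ) : WithBot ℕ) := by
  have hm : ((X - C (node i)) ^ k * cofP node mult i).Monic :=
    ((monic_X_sub_C _).pow k).mul (cofP_monic _ _ _)
  rw [degree_eq_natDegree hm.ne_zero,
    ((monic_X_sub_C _).pow k).natDegree_mul (cofP_monic _ _ _), ← cofP_natDegree node mult i]
  simp only [natDegree_pow, natDegree_X_sub_C, mul_one, Nat.cast_lt]
  omega

lemma quadG_inj {l : ℕ} {node : Fin l → ℂ} (hi : Function.Injective node) {mult : Fin l → ℕ}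
    {w : Fin l → ℕ → ℂ}
    (h : ∀ q : Polynomial ℂ, q.degree < ((∑ i, mult i : ℕ) : WithBot ℕ) → quadG node mult w q = 0)
    (i : Fin l) : ∀ j < mult i, w i j = 0 := by
  by_contra hc
  push Not at hc
  obtain ⟨j, hj, hj0⟩ := hc
  let S := (Finset.range (mult i)).filter fun j => w i j ≠ 0
  have hS : S.Nonempty := ⟨j, by simp [S, hj, hj0]⟩
  obtain ⟨hk1, hk2⟩ := Finset.mem_filter.1 (S.max'_mem hS)
  set k := S.max' hS with hk
  rw [Finset.mem_range] at hk1
  have h1 := quadG_key (node := node) (w := w) hk1 (by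
    intro j hkj hj
    by_contra hne
    exact absurd (S.le_max' j (by simp [S, hj, hne])) (not_le.2 hkj)) 1
  rw [mul_one, h _ (deg_aux node mult i hk1)] at h1
  exact mul_ne_zero hk2 (eval_deriv_ne (cofP_eval_ne hi mult i)) h1.symm

lemma nodalP_dvd {l : ℕ} {node : Fin l → ℂ} (hi : Function.Injective node) {mult : Fin l → ℕ}
    {q : Polynomial ℂ} (h : ∀ i, (X - C (node i)) ^ mult i ∣ q) : nodalP node mult ∣ q :=
  Finset.prod_dvd_of_coprime
    (fun _ _ _ _ hne => (pairwise_coprime_X_sub_C hi hne).pow) fun i _ => h i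

/-- Nondegeneracy of the Hankel form. -/
def NDeg (L : Polynomial ℂ →ₗ[ℂ] ℂ) (n : ℕ) : Prop :=
  ∀ g : Polynomial ℂ, g.degree < (n : WithBot ℕ) → (∀ i < n, L (g * X ^ i) = 0) → g = 0

lemma orth_of_pow {L : Polynomial ℂ →ₗ[ℂ] ℂ} {n : ℕ} {g : Polynomial ℂ}
    (hg : ∀ i < n, L (g * X ^ i) = 0) {h : Polynomial ℂ} (hh : h.degree < (n : WithBot ℕ)) :
    L (g * h) = 0 := by
  by_cases h0 : h = 0
  · simp [h0]
  rw [as_sum_range' h n ((natDegree_lt_iff_degree_lt h0).2 hh), Finset.mul_sum, map_sum]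
  refine Finset.sum_eq_zero fun i hi => ?_
  rw [← C_mul_X_pow_eq_monomial, ← mul_assoc, mul_comm g, mul_assoc, ← smul_eq_C_mul, map_smul,
    hg i (Finset.mem_range.1 hi), smul_zero]

lemma hankel_mulVec {L : Polynomial ℂ →ₗ[ℂ] ℂ} {m : ℕ → ℂ} (hm : ∀ i, m i = L (X ^ i))
    {n : ℕ} (v : Fin n → ℂ) (i : Fin n) :
    ((Matrix.of fun i j : Fin n => m ((i : ℕ) + (j : ℕ))) *ᵥ v) i =
      L ((∑ j : Fin n, C (v j) * X ^ (j : ℕ)) * X ^ (i : ℕ)) := by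
  rw [Finset.sum_mul, map_sum]
  simp only [Matrix.mulVec, dotProduct, Matrix.of_apply]
  refine Finset.sum_congr rfl fun j _ => ?_
  rw [mul_assoc, ← pow_add, ← smul_eq_C_mul, map_smul, hm, smul_eq_mul, mul_comm, add_comm]

lemma deg_sum {n : ℕ} (v : Fin n → ℂ) :
    (∑ j : Fin n, C (v j) * X ^ (j : ℕ)).degree < (n : WithBot ℕ) :=
  degree_sum_fin_lt v

lemma coeff_sum' {n : ℕ} (v : Fin n → ℂ) (k : Fin n) :
    (∑ j : Fin n, C (v j) * X ^ (j : ℕ)).coeff k = v k := by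
  rw [finsetSum_coeff, Finset.sum_eq_single k]
  · simp
  · intro j _ hj
    rw [coeff_C_mul_X_pow, if_neg]
    intro h; exact hj (Fin.ext h.symm)
  · simp

lemma hankel_iff {L : Polynomial ℂ →ₗ[ℂ] ℂ} {m : ℕ → ℂ} (hm : ∀ i, m i = L (X ^ i)) (n : ℕ) :
    hankelDet m n ≠ 0 ↔ NDeg L n := by
  unfold hankelDet
  rw [ne_eq, ← Matrix.exists_mulVec_eq_zero_iff]
  constructor
  · intro h g hg hL
    by_contra hg0
    apply h
    have hgs : g = ∑ j : Fin n, C (g.coeff j) * X ^ (j : ℕ) := by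
      conv_lhs => rw [as_sum_range' g n ((natDegree_lt_iff_degree_lt hg0).2 hg)]
      rw [Finset.sum_range]
      simp [C_mul_X_pow_eq_monomial]
    refine ⟨fun j => g.coeff j, ?_, ?_⟩
    · intro h0
      apply hg0
      rw [hgs]
      exact Finset.sum_eq_zero fun j _ => by rw [congrFun h0 j]; simp
    · ext i
      rw [hankel_mulVec hm, ← hgs]
      exact hL i i.2
  · rintro h ⟨v, hv, hv0⟩
    apply hv
    have := h _ (deg_sum v) (fun i hi => by
      rw [← hankel_mulVec hm v ⟨i, hi⟩, hv0]; rfl)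
    ext k
    rw [← coeff_sum' v k, this]; simp

lemma exists_orth {L : Polynomial ℂ →ₗ[ℂ] ℂ} {m : ℕ → ℂ} (hm : ∀ i, m i = L (X ^ i)) (n : ℕ)
    (h : hankelDet m n ≠ 0) :
    ∃ p : Polynomial ℂ, p.Monic ∧ p.natDegree = n ∧ ∀ i < n, L (p * X ^ i) = 0 := by
  unfold hankelDet at h
  set H := (Matrix.of fun i j : Fin n => m ((i : ℕ) + (j : ℕ))) with hH
  let v : Fin n → ℂ := H⁻¹ *ᵥ (fun i => - m (n + i))
  have hv : H *ᵥ v = fun i : Fin n => - m (n + i) := by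
    rw [Matrix.mulVec_mulVec, Matrix.mul_nonsing_inv _ (isUnit_iff_ne_zero.2 h),
      Matrix.one_mulVec]
  refine ⟨X ^ n + ∑ j : Fin n, C (v j) * X ^ (j : ℕ), monic_X_pow_add (deg_sum v), ?_, ?_⟩
  · apply natDegree_eq_of_degree_eq_some
    rw [degree_add_eq_left_of_degree_lt] <;> rw [degree_X_pow]
    exact deg_sum v
  · intro i hi
    rw [add_mul, map_add, ← hankel_mulVec hm v ⟨i, hi⟩, ← hH, hv, ← pow_add, ← hm]
    simp

lemma exists_nodes (p : Polynomial ℂ) (hp : p.Monic) :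
    ∃ (l : ℕ) (node : Fin l → ℂ) (mult : Fin l → ℕ), Function.Injective node ∧
      (∀ i, 1 ≤ mult i) ∧ nodalP node mult = p := by
  classical
  let S := p.roots.toFinset
  let e := S.equivFin
  refine ⟨S.card, fun i => (e.symm i : ℂ), fun i => p.rootMultiplicity (e.symm i : ℂ), ?_, ?_, ?_⟩
  · intro a b hab
    exact e.symm.injective (Subtype.ext hab)
  · intro i
    have := (e.symm i).2
    rw [Multiset.mem_toFinset, mem_roots hp.ne_zero] at this
    exact (rootMultiplicity_pos hp.ne_zero).2 this
  · unfold nodalP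
    rw [Equiv.prod_comp e.symm (fun s : S => (X - C (s : ℂ)) ^ p.rootMultiplicity (s : ℂ)),
      Finset.prod_coe_sort S (fun s => (X - C s) ^ p.rootMultiplicity s),
      ← prod_multiset_root_eq_finset_root]
    exact prod_multiset_X_sub_C_of_monic_of_roots_card_eq hp
      (IsAlgClosed.card_roots_eq_natDegree)

lemma exists_weights (L : Polynomial ℂ →ₗ[ℂ] ℂ) {l : ℕ} {node : Fin l → ℂ}
    (hi : Function.Injective node) (mult : Fin l → ℕ) :
    ∃ w : Fin l → ℕ → ℂ, ∀ q : Polynomial ℂ, q.degree < ((∑ i, mult i : ℕ) : WithBot ℕ) →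
      L q = quadG node mult w q := by
  classical
  let T0 : Polynomial ℂ →ₗ[ℂ] ((Σ i : Fin l, Fin (mult i)) → ℂ) :=
    LinearMap.pi fun s => (leval (node s.1)).comp ((derivative : ℂ[X] →ₗ[ℂ] ℂ[X]) ^ (s.2 : ℕ))
  have hT0 : ∀ q s, T0 q s = (derivative^[(s.2 : ℕ)] q).eval (node s.1) := by
    intro q s
    simp [T0, Module.End.pow_apply, leval]
  let T := T0.comp (degreeLT ℂ (∑ i, mult i)).subtype
  have hT : LinearMap.ker T = ⊥ := by
    rw [LinearMap.ker_eq_bot']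
    rintro ⟨q, hq⟩ h0
    rw [mem_degreeLT] at hq
    have h1 : nodalP node mult ∣ q := nodalP_dvd hi fun i => dvd_of_eval_deriv fun j hj => by
      rw [← hT0 q ⟨i, ⟨j, hj⟩⟩]
      exact congrFun h0 _
    have : q = 0 := by
      by_contra hq0
      apply not_le.2 hq
      have := degree_le_of_dvd h1 hq0
      rwa [degree_eq_natDegree (nodalP_monic _ _).ne_zero, nodalP_natDegree] at this
    exact Subtype.ext this
  obtain ⟨S, hS⟩ := LinearMap.exists_leftInverse_of_injective T hT
  let M := (L.comp (degreeLT ℂ (∑ i, mult i)).subtype).comp S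
  refine ⟨fun i j => if h : j < mult i then M (Pi.single ⟨i, ⟨j, h⟩⟩ 1) else 0, fun q hq => ?_⟩
  have h1 : L q = M (T0 q) := by
    have := LinearMap.congr_fun hS ⟨q, mem_degreeLT.2 hq⟩
    simp only [LinearMap.comp_apply, LinearMap.id_apply] at this
    change L q = L (S (T ⟨q, mem_degreeLT.2 hq⟩) : Polynomial ℂ)
    rw [this]
  rw [h1, LinearMap.pi_apply_eq_sum_univ M, Fintype.sum_sigma]
  unfold quadG
  refine Finset.sum_congr rfl fun i _ => ?_
  rw [Finset.sum_range]
  refine Finset.sum_congr rfl fun j _ => ?_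
  beta_reduce
  rw [hT0, smul_eq_mul, mul_comm, dif_pos j.2]
  congr 2
  ext s
  simp [Pi.single_apply, eq_comm]

lemma deg_mul_lt {n : ℕ} {a b : Polynomial ℂ} (ha : a.degree < (n : WithBot ℕ))
    (hb : b.degree < (n : WithBot ℕ)) : (a * b).degree < ((2 * n : ℕ) : WithBot ℕ) := by
  by_cases h0 : a * b = 0
  · rw [h0, degree_zero]; exact WithBot.bot_lt_coe _
  · have ha0 := left_ne_zero_of_mul h0
    have hb0 := right_ne_zero_of_mul h0
    rw [← natDegree_lt_iff_degree_lt h0, natDegree_mul ha0 hb0]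
    rw [← natDegree_lt_iff_degree_lt ha0] at ha
    rw [← natDegree_lt_iff_degree_lt hb0] at hb
    omega

lemma gauss_ndeg {L : Polynomial ℂ →ₗ[ℂ] ℂ} {n : ℕ} (G : GaussQuadrature L n) : NDeg L n := by
  intro g hg hL
  by_contra hg0
  have hd : nodalP G.node G.mult ∣ g := by
    refine nodalP_dvd G.node_inj fun i => ?_
    rw [← le_rootMultiplicity_iff hg0]
    by_contra hlt
    push Not at hlt
    obtain ⟨r, hr, hrd⟩ := exists_eq_pow_rootMultiplicity_mul_and_not_dvd g hg0 (G.node i)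
    set k := g.rootMultiplicity (G.node i) with hk
    have hre : r.eval (G.node i) ≠ 0 := fun h => hrd (dvd_iff_isRoot.2 h)
    have hpos := G.mult_pos i
    have hhd := deg_aux G.node G.mult i (k := G.mult i - 1 - k) (by omega)
    rw [G.sum_mult] at hhd
    have h1 := orth_of_pow hL hhd
    have h2 : g * ((X - C (G.node i)) ^ (G.mult i - 1 - k) * cofP G.node G.mult i) =
        (X - C (G.node i)) ^ (G.mult i - 1) * (cofP G.node G.mult i * r) := by
      have : G.mult i - 1 = k + (G.mult i - 1 - k) := by omega
      conv_rhs => rw [this, pow_add]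
      conv_lhs => rw [hr]
      ring
    have h3 := G.exactness _ (deg_mul_lt hg hhd)
    rw [h1, h2] at h3
    change 0 = quadG G.node G.mult G.weight _ at h3
    rw [quadG_key (by omega) (by intro j _ _; omega)] at h3
    refine mul_ne_zero (G.top_weight_ne i) (eval_deriv_ne ?_) h3.symm
    rw [eval_mul]
    exact mul_ne_zero (cofP_eval_ne G.node_inj _ _) hre
  apply not_le.2 hg
  have := degree_le_of_dvd hd hg0
  rwa [degree_eq_natDegree (nodalP_monic _ _).ne_zero, nodalP_natDegree, G.sum_mult] at this

lemma gauss_orth {L : Polynomial ℂ →ₗ[ℂ] ℂ} {n : ℕ} (G : GaussQuadrature L n) :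
    ∀ i < n, L (nodalP G.node G.mult * X ^ i) = 0 := by
  intro i hi
  rw [G.exactness]
  · exact quadG_zero (w := G.weight) (dvd_mul_right _ _)
  · rw [degree_mul, degree_X_pow, degree_eq_natDegree (nodalP_monic _ _).ne_zero,
      nodalP_natDegree, G.sum_mult]
    norm_cast
    omega

lemma gauss_nodal {L : Polynomial ℂ →ₗ[ℂ] ℂ} {n : ℕ} (G G' : GaussQuadrature L n) :
    nodalP G.node G.mult = nodalP G'.node G'.mult := by
  rw [← sub_eq_zero]
  apply gauss_ndeg G
  · have hd : ∀ G : GaussQuadrature L n, (nodalP G.node G.mult).degree = n := fun G => by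
      rw [degree_eq_natDegree (nodalP_monic _ _).ne_zero, nodalP_natDegree, G.sum_mult]
    rw [← hd G]
    exact degree_sub_lt_left ((hd G).trans (hd G').symm) (nodalP_monic _ _).ne_zero
      ((nodalP_monic _ _).trans (nodalP_monic _ _).symm)
  · intro i hi
    rw [sub_mul, map_sub, gauss_orth G i hi, gauss_orth G' i hi, sub_zero]

lemma nodal_rootMult {l : ℕ} {node : Fin l → ℂ} (hi : Function.Injective node)
    (mult : Fin l → ℕ) (i : Fin l) : (nodalP node mult).rootMultiplicity (node i) = mult i := by
  rw [nodalP_eq node mult i, rootMult_mul (cofP_eval_ne hi mult i)]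

lemma gauss_node {L : Polynomial ℂ →ₗ[ℂ] ℂ} {n : ℕ} (G G' : GaussQuadrature L n)
    (i : Fin G.len) : ∃ i', G'.node i' = G.node i := by
  have h : (nodalP G'.node G'.mult).eval (G.node i) = 0 := by
    rw [← gauss_nodal G G', nodalP_eq G.node G.mult i]
    have := G.mult_pos i
    simp [show G.mult i ≠ 0 by omega]
  unfold nodalP at h
  rw [eval_prod, Finset.prod_eq_zero_iff] at h
  obtain ⟨i', _, h⟩ := h
  refine ⟨i', ?_⟩
  rw [eval_pow] at h
  have := eq_zero_of_pow_eq_zero h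
  simp only [eval_sub, eval_X, eval_C] at this
  exact (sub_eq_zero.1 this).symm

lemma exists_gauss {L : Polynomial ℂ →ₗ[ℂ] ℂ} {m : ℕ → ℂ} (hm : ∀ i, m i = L (X ^ i)) (n : ℕ)
    (h : hankelDet m n ≠ 0) : Nonempty (GaussQuadrature L n) := by
  obtain ⟨p, hp, hpn, hpo⟩ := exists_orth hm n h
  obtain ⟨l, node, mult, hinj, hpos, rfl⟩ := exists_nodes p hp
  rw [nodalP_natDegree] at hpn
  obtain ⟨w, hw⟩ := exists_weights L hinj mult
  rw [hpn] at hw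
  have hadd : ∀ a b, quadG node mult w (a + b) = quadG node mult w a + quadG node mult w b := by
    intro a b
    simp [quadG, mul_add, Finset.sum_add_distrib]
  have hex : ∀ q : Polynomial ℂ, q.degree < ((2 * n : ℕ) : WithBot ℕ) →
      L q = quadG node mult w q := by
    intro q hq
    have h1 : L (nodalP node mult * (q /ₘ nodalP node mult)) = 0 := by
      apply orth_of_pow hpo
      by_cases h0 : q /ₘ nodalP node mult = 0
      · rw [h0, degree_zero]; exact WithBot.bot_lt_coe n
      · have hq0 : q ≠ 0 := by rintro rfl; simp at h0
        have hle : (nodalP node mult).degree ≤ q.degree := by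
          by_contra hc
          exact h0 ((divByMonic_eq_zero_iff hp).2 (not_le.1 hc))
        rw [← natDegree_lt_iff_degree_lt h0, natDegree_divByMonic _ hp, nodalP_natDegree, hpn]
        rw [← natDegree_lt_iff_degree_lt hq0] at hq
        have := natDegree_le_natDegree hle
        rw [nodalP_natDegree, hpn] at this
        have : n ≠ 0 := by
          rintro rfl
          omega
        omega
    have h2 : (q %ₘ nodalP node mult).degree < (n : WithBot ℕ) := by
      have := degree_modByMonic_lt q hp
      rwa [degree_eq_natDegree hp.ne_zero, nodalP_natDegree, hpn] at this
    rw [← modByMonic_add_div q (nodalP node mult), map_add, hadd, h1,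
      quadG_zero (dvd_mul_right _ _), hw _ h2]
  refine ⟨⟨l, node, mult, w, hinj, hpos, hpn, ?_, hex⟩⟩
  intro i h0
  have hi := hpos i
  have hd := deg_aux node mult i (k := mult i - 1) (by omega)
  rw [hpn] at hd
  have := (hankel_iff hm n).1 h _ hd (by
    intro j hj
    have hjd : (X ^ j : Polynomial ℂ).degree < (n : WithBot ℕ) := by
      rw [degree_X_pow]; exact_mod_cast hj
    rw [hex _ (deg_mul_lt hd hjd), mul_assoc,
      quadG_key (by omega) (by intro j _ _; omega), h0, zero_mul])
  exact (((monic_X_sub_C _).pow _).mul (cofP_monic _ _ _)).ne_zero this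

/-- For `n ≥ 1`, an `n`-node Gauss quadrature for `L` exists iff
`Δ_{n−1} ≠ 0`; moreover it is unique (nodes, multiplicities and weights are determined
up to reordering of the nodes). -/
theorem stmt11 (L : Polynomial ℂ →ₗ[ℂ] ℂ) (m : ℕ → ℂ) (hm : ∀ i, m i = L (X ^ i))
    (n : ℕ) (hn : 1 ≤ n) :
    (Nonempty (GaussQuadrature L n) ↔ hankelDet m n ≠ 0) ∧
    (∀ G G' : GaussQuadrature L n, ∃ e : Fin G.len ≃ Fin G'.len,
      ∀ i, G'.node (e i) = G.node i ∧ G'.mult (e i) = G.mult i ∧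
        ∀ j < G.mult i, G'.weight (e i) j = G.weight i j) := by
  refine ⟨⟨fun ⟨G⟩ => (hankel_iff hm n).2 (gauss_ndeg G), exists_gauss hm n⟩, ?_⟩
  intro G G'
  choose f hf using gauss_node G G'
  choose f' hf' using gauss_node G' G
  let e : Fin G.len ≃ Fin G'.len :=
    { toFun := f
      invFun := f'
      left_inv := fun i => G.node_inj (by rw [hf', hf])
      right_inv := fun i => G'.node_inj (by rw [hf, hf']) }
  have hen : ∀ i, G'.node (e i) = G.node i := hf
  have hem : ∀ i, G'.mult (e i) = G.mult i := by
    intro i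
    rw [← nodal_rootMult G'.node_inj G'.mult (e i), ← gauss_nodal G G', hen, nodal_rootMult G.node_inj]
  refine ⟨e, fun i => ⟨hen i, hem i, ?_⟩⟩
  have := quadG_inj (node := G.node) G.node_inj (mult := G.mult)
    (w := fun i j => G'.weight (e i) j - G.weight i j) (by
      intro q hq
      rw [G.sum_mult] at hq
      have hq2 : q.degree < ((2 * n : ℕ) : WithBot ℕ) :=
        lt_of_lt_of_le hq (by exact_mod_cast (by omega : n ≤ 2 * n))
      have h1 := G.exactness q hq2
      have h2 := G'.exactness q hq2
      rw [← Equiv.sum_comp e] at h2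
      simp only [hen, hem] at h2
      unfold quadG
      simp only [sub_mul, Finset.sum_sub_distrib]
      rw [← h1, ← h2, sub_self]) i
  intro j hj
  exact sub_eq_zero.1 (this j hj)
end

section
/- Let T be an n×n complex matrix that is lower Hessenberg with nonzero superdiagonal, i.e. T_{i,j} = 0 for j > i+1 and T_{i,i+1} ≠ 0 for i = 1,…,n−1. Let p_0, p_1,…, p_n be polynomials with deg p_j = j, and let β_n ≠ 0, such that λ·p_{j−1}(λ) = Σ_{i=1}^{n} T_{j,i} p_{i−1}(λ) for j = 1,…,n−1 and λ·p_{n−1}(λ) = Σ_{i=1}^{n} T_{n,i} p_{i−1}(λ) + β_n p_n(λ). Then p_n is a nonzero scalar multiple of the characteristic polynomial of T. -/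
open Polynomial Matrix

/-- Let `T` be an `n × n` lower Hessenberg matrix with nonzero
superdiagonal, and let `p_0, …, p_n` with `deg p_j = j` and `β_n ≠ 0` satisfy
`λ p_{j−1} = Σ_i T_{j,i} p_{i−1}` for `j = 1, …, n−1` and
`λ p_{n−1} = Σ_i T_{n,i} p_{i−1} + β_n p_n`. Then `p_n` is a nonzero scalar multiple of
the characteristic polynomial of `T`. -/
theorem stmt13 (n : ℕ) (hn : 1 ≤ n) (T : Matrix (Fin n) (Fin n) ℂ)
    (hhess : ∀ i j : Fin n, (i : ℕ) + 1 < (j : ℕ) → T i j = 0)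
    (hsuper : ∀ i j : Fin n, (j : ℕ) = (i : ℕ) + 1 → T i j ≠ 0)
    (p : ℕ → Polynomial ℂ) (hdeg : ∀ j ≤ n, (p j).degree = (j : WithBot ℕ))
    (β : ℂ) (hβ : β ≠ 0)
    (hrec : ∀ j : Fin n, X * p (j : ℕ) =
      (∑ i : Fin n, C (T j i) * p (i : ℕ)) +
        (if (j : ℕ) = n - 1 then C β * p n else 0)) :
    ∃ c : ℂ, c ≠ 0 ∧ p n = C c * T.charpoly := by
  have h0 : 0 < n := hn
  let z : Fin n := ⟨0, h0⟩
  let l : Fin n := ⟨n - 1, by omega⟩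
  have hM : (charmatrix T) *ᵥ (fun i : Fin n => p (i : ℕ)) = Pi.single l (C β * p n) := by
    funext j
    have h1 : ((charmatrix T) *ᵥ (fun i : Fin n => p (i : ℕ))) j
        = X * p (j : ℕ) - ∑ i : Fin n, C (T j i) * p (i : ℕ) := by
      simp only [charmatrix, Matrix.sub_mulVec, Pi.sub_apply]
      congr 1
      simp [Matrix.scalar_apply, Matrix.mulVec_diagonal]
    rw [h1, hrec j, add_sub_cancel_left, Pi.single_apply]
    simp only [Fin.ext_iff, l]
  have hA : T.charpoly * p 0 = (charmatrix T).adjugate z l * (C β * p n) := by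
    have h2 := congrFun (congrArg (fun v => (charmatrix T).adjugate *ᵥ v) hM) z
    simp only [Matrix.mulVec_mulVec, Matrix.adjugate_mul, Matrix.smul_mulVec, Matrix.one_mulVec,
      Pi.smul_apply, smul_eq_mul, Matrix.mulVec_single] at h2
    simpa [Matrix.charpoly, z, mul_comm] using h2
  have hp0 : (p 0).degree = 0 := by simpa using hdeg 0 (Nat.zero_le _)
  obtain ⟨a, ha⟩ : ∃ a, p 0 = C a := ⟨_, eq_C_of_degree_eq_zero hp0⟩
  have ha0 : a ≠ 0 := by
    rintro rfl
    simp [ha] at hp0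
  have hpn : p n ≠ 0 := by
    intro h
    have := hdeg n le_rfl
    simp [h] at this
  have hpnd : (p n).natDegree = n := natDegree_eq_of_degree_eq_some (hdeg n le_rfl)
  have hc : T.charpoly ≠ 0 := (Matrix.charpoly_monic T).ne_zero
  have hcd : T.charpoly.natDegree = n := by simp [Matrix.charpoly_natDegree_eq_dim]
  have hCa : (C a : ℂ[X]) ≠ 0 := by simpa using ha0
  have hCb : (C β : ℂ[X]) ≠ 0 := by simpa using hβ
  generalize (charmatrix T).adjugate z l = q at hA
  have hq : q ≠ 0 := by
    rintro rfl
    rw [zero_mul, ha] at hA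
    exact mul_ne_zero hc hCa hA
  have hqd : q.natDegree = 0 := by
    have h3 := congrArg natDegree hA
    rw [ha, natDegree_mul hc hCa, natDegree_mul hq (mul_ne_zero hCb hpn),
      natDegree_mul hCb hpn, hpnd, hcd, natDegree_C, natDegree_C] at h3
    omega
  obtain ⟨d, rfl⟩ : ∃ d, q = C d := ⟨_, eq_C_of_natDegree_eq_zero hqd⟩
  have hd : d ≠ 0 := by
    rintro rfl
    simp at hq
  refine ⟨a / (d * β), div_ne_zero ha0 (mul_ne_zero hd hβ), ?_⟩
  have h4 : C (d * β) * p n = C a * T.charpoly := by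
    rw [C_mul, mul_assoc, ← hA, ha, mul_comm]
  have h5 : (C (d * β) : ℂ[X]) ≠ 0 := by simpa using ⟨hd, hβ⟩
  apply mul_left_cancel₀ h5
  rw [h4, ← mul_assoc, ← C_mul, mul_div_cancel₀ _ (mul_ne_zero hd hβ)]
end

section
/- Let L : 𝒫 → ℂ be a linear functional with moments m_j = L(λ^j), and suppose there exist polynomials p_0, p_1,…, p_n with deg p_j = j satisfying the orthonormality conditions L(p_i p_j) = 0 for i ≠ j and L(p_j p_j) = 1 (0 ≤ i,j ≤ n), together with complex coefficients α_0,…,α_{n−1} and β_1,…,β_n with β_j ≠ 0 such that β_j p_j(λ) = (λ − α_{j−1}) p_{j−1}(λ) − β_{j−1} p_{j−2}(λ) for j = 1,…,n (with β_0 = 0, p_{−1} = 0). Let J_n be the n×n tridiagonal complex Jacobi matrix with diagonal entries α_0,…,α_{n−1} and with β_1,…,β_{n−1} on both the sub- and superdiagonal. Then m_0 · (J_n^j)_{1,1} = m_j for j = 0,1,…,2n−1. -/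
open Polynomial Matrix

/-- Suppose `p_0, …, p_n` (`deg p_j = j`) are orthonormal w.r.t. the
linear functional `L` and satisfy the three-term recurrence
`β_j p_j = (λ − α_{j−1}) p_{j−1} − β_{j−1} p_{j−2}` (`β_0 = 0`, `p_{−1} = 0`, `β_j ≠ 0`
for `1 ≤ j ≤ n`). Let `J_n` be the tridiagonal complex Jacobi matrix with diagonal
`α_0, …, α_{n−1}` and `β_1, …, β_{n−1}` on the sub- and superdiagonal. Then
`m_0 · (J_n^j)_{1,1} = m_j` for `j = 0, …, 2n−1`. -/
theorem stmt16 (n : ℕ) (hn : 1 ≤ n) (L : Polynomial ℂ →ₗ[ℂ] ℂ) (m : ℕ → ℂ)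
    (hm : ∀ j, m j = L (X ^ j))
    (p : ℕ → Polynomial ℂ) (hdeg : ∀ j ≤ n, (p j).degree = (j : WithBot ℕ))
    (horth : ∀ i ≤ n, ∀ j ≤ n, i ≠ j → L (p i * p j) = 0)
    (hnorm : ∀ j ≤ n, L (p j * p j) = 1)
    (α β : ℕ → ℂ) (hβ0 : β 0 = 0) (hβne : ∀ j, 1 ≤ j → j ≤ n → β j ≠ 0)
    (hrec : ∀ j, 1 ≤ j → j ≤ n →
      C (β j) * p j = (X - C (α (j - 1))) * p (j - 1) - C (β (j - 1)) * p (j - 2))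
    (J : Matrix (Fin n) (Fin n) ℂ)
    (hJ : ∀ i k : Fin n, J i k =
      if (i : ℕ) = (k : ℕ) then α (i : ℕ)
      else if (k : ℕ) = (i : ℕ) + 1 then β ((i : ℕ) + 1)
      else if (i : ℕ) = (k : ℕ) + 1 then β ((k : ℕ) + 1)
      else 0) :
    ∀ j < 2 * n, m 0 * (J ^ j) ⟨0, by omega⟩ ⟨0, by omega⟩ = m j := by
  have hX : ∀ i < n, X * p i = C (β (i+1)) * p (i+1) + C (α i) * p i + C (β i) * p (i-1) := by
    intro i hi
    have h := hrec (i+1) (by omega) (by omega)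
    have e1 : i + 1 - 1 = i := by omega
    have e2 : i + 1 - 2 = i - 1 := by omega
    rw [e1, e2] at h
    rw [h]; ring
  have hL : ∀ i < n, ∀ k, ∀ q : Polynomial ℂ, L (X ^ (k+1) * p i * q) =
      β (i+1) * L (X ^ k * p (i+1) * q) + α i * L (X ^ k * p i * q)
        + β i * L (X ^ k * p (i-1) * q) := by
    intro i hi k q
    have : X ^ (k+1) * p i * q = β (i+1) • (X ^ k * p (i+1) * q) + α i • (X ^ k * p i * q)
        + β i • (X ^ k * p (i-1) * q) := by
      simp only [smul_eq_C_mul]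
      calc X ^ (k+1) * p i * q = X ^ k * (X * p i) * q := by ring
        _ = _ := by rw [hX i hi]; ring
    rw [this]; simp
  have hA : ∀ k i, i + k < n → L (X ^ k * p i * p n) = 0 := by
    intro k
    induction k with
    | zero =>
      intro i hi
      simpa using horth i (by omega) n le_rfl (by omega)
    | succ k ih =>
      intro i hi
      rw [hL i (by omega), ih _ (by omega), ih _ (by omega), ih _ (by omega)]
      simp
  have hp0 : ∃ c, p 0 = C c := ⟨_, eq_C_of_degree_le_zero (by rw [hdeg 0 (by omega)]; simp)⟩
  obtain ⟨c, hc⟩ := hp0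
  have hB : ∀ j, ∀ i : Fin n, (i : ℕ) + j < 2 * n →
      (J ^ j) i ⟨0, by omega⟩ = L (X ^ j * p i * p 0) := by
    intro j
    induction j with
    | zero =>
      intro i hi
      by_cases h : (i : ℕ) = 0
      · have : i = ⟨0, by omega⟩ := Fin.ext h
        rw [pow_zero, Matrix.one_apply, if_pos this, h]
        simp [hnorm 0 (by omega)]
      · have h' : i ≠ ⟨0, by omega⟩ := fun e => h (congrArg Fin.val e)
        simp [Matrix.one_apply_ne h', horth i (by omega) 0 (by omega) h]
    | succ j ih =>
      intro i hi
      rw [pow_succ', Matrix.mul_apply, hL i i.2]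
      obtain ⟨F, hF⟩ : ∃ F : ℕ → ℂ, F = (fun t : ℕ => (if (i : ℕ) + 1 = t then β (i + 1) * L (X ^ j * p t * p 0) else 0)
            + (if (i : ℕ) = t then α i * L (X ^ j * p t * p 0) else 0)
            + (if (i : ℕ) - 1 = t then β i * L (X ^ j * p t * p 0) else 0)) := ⟨_, rfl⟩
      have h1 : ∀ k : Fin n, J i k * (J ^ j) k ⟨0, by omega⟩ =
          F k := by
        intro k
        rw [hJ, hF]
        by_cases hk : (k : ℕ) ≤ i + 1
        · rw [ih k (by omega)]
          by_cases a : (i : ℕ) = k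
          · by_cases b : (i : ℕ) - 1 = k
            · have hi0 : (i : ℕ) = 0 := by omega
              have hk0 : (k : ℕ) = 0 := by omega
              simp [hi0, hk0, hβ0]
            · simp only [if_pos a, if_neg b, if_neg (show ¬ ((i : ℕ) + 1 = k) by omega)]
              ring
          · by_cases b : (k : ℕ) = i + 1
            · simp only [if_neg a, if_pos b, if_pos b.symm,
                if_neg (show ¬ ((i : ℕ) - 1 = k) by omega)]
              ring
            · by_cases d : (i : ℕ) = k + 1
              · simp only [if_neg a, if_neg b, if_pos d, if_neg (Ne.symm b),
                  if_pos (show (i : ℕ) - 1 = k by omega)]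
                rw [← d]; ring
              · simp only [if_neg a, if_neg b, if_neg d, if_neg (Ne.symm b),
                  if_neg (show ¬ ((i : ℕ) - 1 = k) by omega)]
                ring
        · rw [if_neg (by omega), if_neg (by omega), if_neg (by omega)]
          simp only [if_neg (show ¬ ((i : ℕ) + 1 = k) by omega),
            if_neg (show ¬ ((i : ℕ) = k) by omega), if_neg (show ¬ ((i : ℕ) - 1 = k) by omega)]
          ring
      rw [Finset.sum_congr rfl (fun k _ => h1 k), Fin.sum_univ_eq_sum_range F n, hF]
      rw [Finset.sum_add_distrib, Finset.sum_add_distrib, Finset.sum_ite_eq, Finset.sum_ite_eq,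
        Finset.sum_ite_eq, if_pos (Finset.mem_range.2 i.2),
        if_pos (Finset.mem_range.2 (show (i : ℕ) - 1 < n by omega))]
      by_cases hin : (i : ℕ) + 1 < n
      · rw [if_pos (Finset.mem_range.2 hin)]
      · have e : (i : ℕ) + 1 = n := by omega
        rw [if_neg (by simpa using hin), e]
        have : X ^ j * p n * p 0 = X ^ j * p 0 * p n := by ring
        rw [this, hA j 0 (by omega)]
        simp
  intro j hj
  have hcc : ∀ k, L (X ^ k * p 0 * p 0) = c * c * m k := by
    intro k
    have : X ^ k * p 0 * p 0 = (c * c) • (X ^ k : Polynomial ℂ) := by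
      rw [hc, smul_eq_C_mul, C_mul]; ring
    rw [this, hm]; simp
  have h0 : c * c * m 0 = 1 := by
    rw [← hcc 0, ← hnorm 0 (by omega)]; simp
  rw [hB j _ (by simpa using hj)]
  change m 0 * L (X ^ j * p 0 * p 0) = m j
  rw [hcc j]
  linear_combination m j * h0
end

section
/- Let L : 𝒫 → ℂ have moments m_j and Hankel determinants Δ_k (with Δ_{−1} = 1). Let ν(0) = 0 < ν(1) < ν(2) < ⋯ be exactly the indices k ≥ 0 with Δ_{k−1} ≠ 0 (the regular indices), and let n satisfy ν(t) ≤ n < ν(t+1) with n ≥ ν(1), where ν(t+1) = +∞ if ν(t) is the largest regular index. Let p_0, p_1,…, p_n be polynomials with deg p_j = j, p_0 a nonzero constant, such that for each j ≥ 1 the polynomial p_j satisfies L(p_j λ^i) = 0 for i = 0,…,ρ(j)−1, where ρ(j) = max{ν(s) : ν(s) ≤ j} (so p_j is the regular FOP when j is regular and a (j−ρ(j))-quasi-orthogonal polynomial otherwise), and suppose they satisfy the recurrences: for ν(s) < j < ν(s+1), β_j p_j(λ) = λ p_{j−1}(λ) − Σ_{i=ρ(j−1)}^{j−1} α_{j,i}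 p_i(λ) with β_j ≠ 0; and for j = ν(s+1), β_j p_j(λ) = λ p_{j−1}(λ) − Σ_{i=ν(s)}^{j−1} α_{j,i} p_i(λ) − γ_j p_{ν(s−1)}(λ) with β_j ≠ 0 (where p_{ν(−1)} = 0 and γ_{ν(1)} = 0). Let T_n be the n×n matrix encoding these recurrences, i.e. the unique matrix such that λ·p_{j−1}(λ) = Σ_{i=1}^{n} (T_n)_{j,i} p_{i−1}(λ) + δ_{j,n} β_n p_n(λ) for j = 1,…,n. Set μ = (β_1 β_2 ⋯ β_{ν(1)−1})^{−1} if ν(1) > 1 and μ = 1 if ν(1) = 1. Then μ · m_{ν(1)−1} · (T_n^k)_{1,ν(1)} = m_k for every k with 0 ≤ k ≤ ν(t) + ν(t+1) − 2 (for all k ≥ 0 when ν(t+1) = +∞). -/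
open Polynomial Matrix
open scoped Classical

theorem aux_expand_s17 (L : Polynomial ℂ →ₗ[ℂ] ℂ) (m : ℕ → ℂ) (hm : ∀ j, m j = L (X ^ j))
    (k : ℕ) (c : Fin k → ℂ) (j : ℕ) :
    L ((∑ i : Fin k, C (c i) * X ^ (i : ℕ)) * X ^ j) = ∑ i : Fin k, m (j + (i : ℕ)) * c i := by
  rw [Finset.sum_mul, map_sum]
  refine Finset.sum_congr rfl fun i _ => ?_
  rw [mul_assoc, ← pow_add, ← smul_eq_C_mul, map_smul, hm, smul_eq_mul, mul_comm, add_comm]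

theorem aux_repr (k : ℕ) (r : Polynomial ℂ) (hr : r.degree < (k : WithBot ℕ)) :
    r = ∑ i : Fin k, C (r.coeff (i : ℕ)) * X ^ (i : ℕ) := by
  rw [Fin.sum_univ_eq_sum_range (fun i => C (r.coeff i) * X ^ i) k]
  ext a
  simp only [finsetSum_coeff, coeff_C_mul, coeff_X_pow]
  by_cases ha : a < k
  · simp [ha]
  · have : r.coeff a = 0 := coeff_eq_zero_of_degree_lt
      (lt_of_lt_of_le hr (by exact_mod_cast not_lt.mp ha))
    simp [ha, this]

theorem aux_A (L : Polynomial ℂ →ₗ[ℂ] ℂ) (m : ℕ → ℂ) (hm : ∀ j, m j = L (X ^ j))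
    (k : ℕ) (hk : hankelDet m k ≠ 0) (r : Polynomial ℂ) (hr : r.degree < (k : WithBot ℕ))
    (h : ∀ j < k, L (r * X ^ j) = 0) : r = 0 := by
  have hv : (fun i : Fin k => r.coeff (i : ℕ)) = 0 := by
    refine Matrix.eq_zero_of_mulVec_eq_zero hk ?_
    ext j
    have := h j j.2
    rw [aux_repr k r hr, aux_expand_s17 L m hm] at this
    simpa [Matrix.mulVec, dotProduct] using this
  rw [aux_repr k r hr]
  refine Finset.sum_eq_zero fun i _ => ?_
  have := congrFun hv i
  simp only [Pi.zero_apply] at this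
  simp [this]

theorem aux_B (L : Polynomial ℂ →ₗ[ℂ] ℂ) (m : ℕ → ℂ) (hm : ∀ j, m j = L (X ^ j))
    (k : ℕ) (h : ∀ q : Polynomial ℂ, q.degree < (k : WithBot ℕ) →
      (∀ j < k, L (q * X ^ j) = 0) → q = 0) : hankelDet m k ≠ 0 := by
  intro h0
  obtain ⟨v, hv, hv0⟩ := Matrix.exists_mulVec_eq_zero_iff.mpr h0
  apply hv
  have hq := h (∑ i : Fin k, C (v i) * X ^ (i : ℕ)) ?_ ?_
  · ext a
    have := congrArg (fun q => q.coeff (a : ℕ)) hq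
    simp only [finsetSum_coeff, coeff_C_mul, coeff_X_pow, coeff_zero, Fin.val_inj] at this
    simpa using this
  · refine (degree_sum_le _ _).trans_lt ?_
    refine (Finset.sup_lt_iff (WithBot.bot_lt_coe k)).mpr ?_
    intro i _
    exact (degree_C_mul_X_pow_le _ _).trans_lt (WithBot.coe_lt_coe.mpr i.2)
  · intro j hj
    rw [aux_expand_s17 L m hm]
    have := congrFun hv0 ⟨j, hj⟩
    simpa [Matrix.mulVec, dotProduct] using this

theorem aux_L (L : Polynomial ℂ →ₗ[ℂ] ℂ) (P q : Polynomial ℂ) (N : ℕ)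
    (h : ∀ i < N, L (P * X ^ i) = 0) (hq : q.degree < (N : WithBot ℕ)) : L (P * q) = 0 := by
  rw [aux_repr N q hq, Finset.mul_sum, map_sum]
  refine Finset.sum_eq_zero fun i _ => ?_
  rw [mul_left_comm, ← smul_eq_C_mul, map_smul, h i i.2, smul_zero]

theorem aux_lead (L : Polynomial ℂ →ₗ[ℂ] ℂ) (P q : Polynomial ℂ) (N : ℕ)
    (h : ∀ i < N, L (P * X ^ i) = 0) (hq : q.degree ≤ (N : WithBot ℕ)) :
    L (P * q) = q.coeff N * L (P * X ^ N) := by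
  have h1 : q = (q - C (q.coeff N) * X ^ N) + C (q.coeff N) * X ^ N := by ring
  have h2 : (q - C (q.coeff N) * X ^ N).degree < (N : WithBot ℕ) := by
    rw [degree_lt_iff_coeff_zero]
    intro a ha
    rcases ha.eq_or_lt with rfl | ha
    · simp
    · rw [coeff_sub, coeff_C_mul, coeff_X_pow, if_neg (by omega),
        coeff_eq_zero_of_degree_lt (lt_of_le_of_lt hq (by exact_mod_cast ha))]
      simp
  conv_lhs => rw [h1]
  rw [mul_add, map_add, aux_L L P _ N h h2, zero_add, mul_left_comm, ← smul_eq_C_mul, map_smul,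
    smul_eq_mul]

theorem aux_D (L : Polynomial ℂ →ₗ[ℂ] ℂ) (m : ℕ → ℂ) (hm : ∀ j, m j = L (X ^ j))
    (P : Polynomial ℂ) (ν I : ℕ) (hP : P.degree = (ν : WithBot ℕ)) (hν : hankelDet m ν ≠ 0)
    (hνI : ν ≤ I) (h0 : ∀ i < I, L (P * X ^ i) = 0) (hI : L (P * X ^ I) ≠ 0) :
    hankelDet m (I + 1) ≠ 0 := by
  have hP0 : P ≠ 0 := by rintro rfl; simp at hP
  refine aux_B L m hm _ fun q hq hqj => ?_
  by_cases hqP : q.degree < P.degree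
  · refine aux_A L m hm ν hν q (hP ▸ hqP) fun j hj => hqj j (by omega)
  rw [not_lt] at hqP
  by_contra hq0
  have hdiv := degree_add_div hP0 hqP
  have hsplit := EuclideanDomain.div_add_mod q P
  set s := q / P with hs
  set r := q % P with hr
  have hs0 : s ≠ 0 := by
    rintro h; rw [h] at hdiv; simp at hdiv; exact hq0 (degree_eq_bot.mp hdiv.symm)
  have hsd : ν + s.natDegree ≤ I := by
    rw [← hdiv, hP, degree_eq_natDegree hs0] at hq
    have : ν + s.natDegree < I + 1 := by exact_mod_cast hq
    omega
  have hrd : r.degree < (ν : WithBot ℕ) := by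
    rw [← hP]; exact EuclideanDomain.mod_lt q hP0
  have hr0 : r = 0 := by
    refine aux_A L m hm ν hν r hrd fun j hj => ?_
    have h1 := hqj j (by omega)
    rw [← hsplit, add_mul, map_add, mul_assoc,
      aux_L L P (s * X ^ j) I h0 ?_, zero_add] at h1
    · exact h1
    · rw [degree_mul, degree_X_pow, degree_eq_natDegree hs0]
      have : s.natDegree + j < I := by omega
      exact_mod_cast this
  have h2 := hqj (I - s.natDegree) (by omega)
  rw [← hsplit, hr0, add_zero, mul_assoc, aux_lead L P _ I h0] at h2
  · rcases mul_eq_zero.mp h2 with h | h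
    · have e : I = s.natDegree + (I - s.natDegree) := by omega
      rw [e, add_tsub_cancel_left, coeff_mul_X_pow] at h
      exact hs0 (leadingCoeff_eq_zero.mp h)
    · exact hI h
  · rw [degree_mul, degree_X_pow, degree_eq_natDegree hs0]
    have : s.natDegree + (I - s.natDegree) ≤ I := by omega
    exact_mod_cast this

/-- Orthogonality of a regular FOP up to the next regular index. -/
theorem aux_E (L : Polynomial ℂ →ₗ[ℂ] ℂ) (m : ℕ → ℂ) (hm : ∀ j, m j = L (X ^ j))
    (P : Polynomial ℂ) (ν N : ℕ) (hP : P.degree = (ν : WithBot ℕ)) (hν : hankelDet m ν ≠ 0)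
    (h0 : ∀ i < ν, L (P * X ^ i) = 0) (hN : ∀ k, ν < k → k ≤ N → hankelDet m k = 0) :
    ∀ i < N, L (P * X ^ i) = 0 := by
  intro i
  induction i using Nat.strong_induction_on with
  | _ i ih =>
    intro hi
    by_contra hne
    have hνi : ν ≤ i := by
      by_contra hlt
      exact hne (h0 i (by omega))
    exact aux_D L m hm P ν i hP hν hνi (fun a ha => ih a ha (by omega)) hne
      (hN _ (by omega) (by omega))

/-- The same for a quasi-orthogonal polynomial of higher degree. -/
theorem aux_F (L : Polynomial ℂ →ₗ[ℂ] ℂ) (m : ℕ → ℂ) (hm : ∀ j, m j = L (X ^ j))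
    (P Q : Polynomial ℂ) (ν n N : ℕ) (hP : P.degree = (ν : WithBot ℕ))
    (hQ : Q.degree = (n : WithBot ℕ)) (hνn : ν ≤ n) (hν : hankelDet m ν ≠ 0)
    (h0 : ∀ i < ν, L (P * X ^ i) = 0) (h0Q : ∀ i < ν, L (Q * X ^ i) = 0)
    (hN : ∀ k, ν < k → k ≤ N → hankelDet m k = 0) (hnN : n ≤ N) :
    ∀ i, n + i < N + ν → L (Q * X ^ i) = 0 := by
  have hP0 : P ≠ 0 := by rintro rfl; simp at hP
  have hE := aux_E L m hm P ν N hP hν h0 hN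
  have hdiv := degree_add_div hP0 (q := P) (p := Q) (by rw [hP, hQ]; exact_mod_cast hνn)
  have hsplit := EuclideanDomain.div_add_mod Q P
  set s := Q / P with hs
  set r := Q % P with hr
  have hs0 : s ≠ 0 := by
    rintro h; rw [h, hQ] at hdiv; simp at hdiv
  have hsd : ν + s.natDegree = n := by
    rw [hP, hQ, degree_eq_natDegree hs0] at hdiv
    exact_mod_cast hdiv
  have hrd : r.degree < (ν : WithBot ℕ) := by
    rw [← hP]; exact EuclideanDomain.mod_lt Q hP0
  have key : ∀ i, n + i < N + ν → L (P * (s * X ^ i)) = 0 := by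
    intro i hi
    refine aux_L L P (s * X ^ i) N hE ?_
    rw [degree_mul, degree_X_pow, degree_eq_natDegree hs0]
    have : s.natDegree + i < N := by omega
    exact_mod_cast this
  have hr0 : r = 0 := by
    refine aux_A L m hm ν hν r hrd fun j hj => ?_
    have h1 := h0Q j hj
    rw [← hsplit, add_mul, map_add, mul_assoc, key j (by omega), zero_add] at h1
    exact h1
  intro i hi
  rw [← hsplit, hr0, add_zero, mul_assoc]
  exact key i hi

/-- Powers of `T` represent multiplication by `X ^ k` modulo `p n`. -/
theorem aux_T (n : ℕ) (hn : 0 < n) (p : ℕ → Polynomial ℂ) (b : ℂ)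
    (T : Matrix (Fin n) (Fin n) ℂ)
    (hT : ∀ j : Fin n, X * p (j : ℕ) =
      (∑ i : Fin n, C (T j i) * p (i : ℕ)) +
        (if (j : ℕ) = n - 1 then C b * p n else 0)) (j : Fin n) (k : ℕ) :
    ∃ q : Polynomial ℂ, X ^ k * p j = (∑ i : Fin n, C ((T ^ k) j i) * p (i : ℕ)) + p n * q := by
  induction k with
  | zero => exact ⟨0, by simp [Matrix.one_apply]⟩
  | succ k ih =>
    obtain ⟨q, hq⟩ := ih
    refine ⟨(∑ i : Fin n, C ((T ^ k) j i) * (if (i : ℕ) = n - 1 then C b else 0)) + X * q, ?_⟩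
    rw [pow_succ', mul_assoc, hq, mul_add, Finset.mul_sum]
    have : ∀ i : Fin n, X * (C ((T ^ k) j i) * p i) =
        (∑ l : Fin n, C ((T ^ k) j i * T i l) * p l) +
          p n * (C ((T ^ k) j i) * (if (i : ℕ) = n - 1 then C b else 0)) := by
      intro i
      rw [mul_left_comm, hT i, mul_add, Finset.mul_sum]
      congr 1
      · exact Finset.sum_congr rfl fun l _ => by rw [C_mul, mul_assoc]
      · split_ifs <;> ring
    rw [Finset.sum_congr rfl fun i _ => this i, Finset.sum_add_distrib, Finset.sum_comm,
      ← Finset.mul_sum, mul_add, ← add_assoc]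
    congr 1
    · congr 1
      refine Finset.sum_congr rfl fun l _ => ?_
      rw [pow_succ, Matrix.mul_apply, map_sum, Finset.sum_mul]
    · ring

/-- Matching Moment Property. Here `ρ j` is the largest regular index
`≤ j` (so `ρ j = ν(s)` when `ν(s) ≤ j < ν(s+1)`), `ν1` is the first regular index `≥ 1`
(`ν(1)`), and `K ∈ ℕ∞` is the first regular index `> n` (`ν(t+1)`, with `K = ⊤` when
`ρ n = ν(t)` is the largest regular index). The polynomials `p_0, …, p_n` (`deg p_j = j`,
`p_j` orthogonal to `λ^i` for `i < ρ j`) satisfy the recurrences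
`β_j p_j = λ p_{j−1} − Σ_{i=ρ(j−1)}^{j−1} α_{j,i} p_i − γ_j p_{ν(s−1)}`, where the `γ`
term occurs only for regular `j = ν(s+1)` with `s ≥ 1` (`p_{ν(s−1)} = p_{ρ(ρ(j−1)−1)}`),
and `T` is the `n × n` matrix encoding these recurrences. With
`μ = (β_1 ⋯ β_{ν(1)−1})⁻¹` (`μ = 1` when `ν(1) = 1`), we have
`μ · m_{ν(1)−1} · (T^k)_{1,ν(1)} = m_k` for all `0 ≤ k ≤ ν(t) + ν(t+1) − 2`
(for all `k` when `ν(t+1) = +∞`). -/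
theorem stmt17 (L : Polynomial ℂ →ₗ[ℂ] ℂ) (m : ℕ → ℂ) (hm : ∀ j, m j = L (X ^ j))
    (n ν1 : ℕ) (ρ : ℕ → ℕ) (K : ℕ∞)
    (p : ℕ → Polynomial ℂ) (α : ℕ → ℕ → ℂ) (β γ : ℕ → ℂ)
    (T : Matrix (Fin n) (Fin n) ℂ)
    (hν1reg : hankelDet m ν1 ≠ 0)
    (hν1pos : 1 ≤ ν1)
    (hν1min : ∀ k, hankelDet m k ≠ 0 → 1 ≤ k → ν1 ≤ k)
    (hν1n : ν1 ≤ n)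
    (hρ : ∀ j ≤ n, hankelDet m (ρ j) ≠ 0 ∧ ρ j ≤ j ∧
      ∀ k, hankelDet m k ≠ 0 → k ≤ j → k ≤ ρ j)
    (hK : (K = ⊤ ∧ ∀ k, n < k → hankelDet m k = 0) ∨
      (∃ k' : ℕ, K = (k' : ℕ∞) ∧ n < k' ∧ hankelDet m k' ≠ 0 ∧
        ∀ k, n < k → k < k' → hankelDet m k = 0))
    (hdeg : ∀ j ≤ n, (p j).degree = (j : WithBot ℕ))
    (horth : ∀ j, 1 ≤ j → j ≤ n → ∀ i < ρ j, L (p j * X ^ i) = 0)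
    (hβne : ∀ j, 1 ≤ j → j ≤ n → β j ≠ 0)
    (hrec : ∀ j, 1 ≤ j → j ≤ n →
      C (β j) * p j = X * p (j - 1)
        - (∑ i ∈ Finset.Icc (ρ (j - 1)) (j - 1), C (α j i) * p i)
        - (if hankelDet m j ≠ 0 ∧ ρ (j - 1) ≠ 0 then
            C (γ j) * p (ρ (ρ (j - 1) - 1)) else 0))
    (hT : ∀ j : Fin n, X * p (j : ℕ) =
      (∑ i : Fin n, C (T j i) * p (i : ℕ)) +
        (if (j : ℕ) = n - 1 then C (β n) * p n else 0)) :
    ∀ k : ℕ, (k : ℕ∞) ≤ (ρ n : ℕ∞) + K - 2 →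
      (∏ i ∈ Finset.Icc 1 (ν1 - 1), β i)⁻¹ * m (ν1 - 1) *
        (T ^ k) ⟨0, by omega⟩ ⟨ν1 - 1, by omega⟩ = m k := by
  have hn : 0 < n := by omega
  -- vanishing of the first moments
  have hdet0 : hankelDet m 0 ≠ 0 := by simp [hankelDet]
  have hfirst : ∀ i < ν1 - 1, L (1 * X ^ i) = 0 := by
    refine aux_E L m hm 1 0 (ν1 - 1) (by simp) hdet0 (by simp) fun k hk hk' => ?_
    by_contra hne
    have := hν1min k hne hk
    omega
  -- leading coefficients
  have hlead : ∀ j ≤ n, (∏ i ∈ Finset.Icc 1 j, β i) * (p j).coeff j = (p 0).coeff 0 := by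
    intro j
    induction j with
    | zero => intro _; simp
    | succ j ih =>
      intro hj
      have h1 := congrArg (fun q => q.coeff (j + 1)) (hrec (j + 1) (by omega) hj)
      have hlow : ∀ i ≤ j, (p i).coeff (j + 1) = 0 := fun i hi =>
        coeff_eq_zero_of_degree_lt (by
          rw [hdeg i (by omega)]; exact_mod_cast Nat.lt_succ_of_le hi)
      simp only [coeff_sub, coeff_C_mul, add_tsub_cancel_right, coeff_X_mul, finsetSum_coeff] at h1
      rw [Finset.sum_eq_zero, sub_zero] at h1
      · have h2 : (if hankelDet m (j + 1) ≠ 0 ∧ ρ j ≠ 0 then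
            C (γ (j + 1)) * p (ρ (ρ j - 1)) else 0).coeff (j + 1) = 0 := by
          split_ifs with hc
          · have ha := (hρ j (by omega)).2.1
            have hb := (hρ (ρ j - 1) (by omega)).2.1
            rw [coeff_C_mul, hlow _ (by omega), mul_zero]
          · simp
        rw [h2, sub_zero] at h1
        rw [Finset.prod_Icc_succ_top (by omega), mul_assoc, h1]
        exact ih (by omega)
      · intro i hi
        rw [hlow i (Finset.mem_Icc.mp hi).2, mul_zero]
  have hp0 : p 0 = C ((p 0).coeff 0) := eq_C_of_degree_eq_zero (by simpa using hdeg 0 (by omega))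
  have hc0 : (p 0).coeff 0 ≠ 0 := by
    have h := hdeg 0 (by omega)
    intro h0
    rw [hp0, h0] at h
    simp at h
  have hprod : (∏ i ∈ Finset.Icc 1 (ν1 - 1), β i) ≠ 0 := by
    refine Finset.prod_ne_zero_iff.mpr fun i hi => ?_
    have := Finset.mem_Icc.mp hi
    exact hβne i (by omega) (by omega)
  have hLtop : L (p (ν1 - 1)) =
      (p 0).coeff 0 * ((∏ i ∈ Finset.Icc 1 (ν1 - 1), β i)⁻¹ * m (ν1 - 1)) := by
    have h1 := aux_lead L 1 (p (ν1 - 1)) (ν1 - 1) hfirst (hdeg _ (by omega)).le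
    rw [one_mul, one_mul, ← hm] at h1
    rw [h1, ← hlead (ν1 - 1) (by omega)]
    field_simp
  have hLne : ∀ i < n, i ≠ ν1 - 1 → L (p i) = 0 := by
    intro i hi hne
    rcases lt_or_gt_of_ne hne with hlt | hgt
    · have h1 := aux_L L 1 (p i) (ν1 - 1) hfirst
        (by rw [hdeg i (by omega)]; exact_mod_cast hlt)
      rwa [one_mul] at h1
    · have h1 := horth i (by omega) (by omega) 0 (by
        have := (hρ i (by omega)).2.2 ν1 hν1reg (by omega)
        omega)
      simpa using h1
  intro k hk
  obtain ⟨q, hq⟩ := aux_T n hn p (β n) T hT ⟨0, hn⟩ k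
  obtain ⟨hρreg, hρle, hρmax⟩ := hρ n le_rfl
  have hρpos : ν1 ≤ ρ n := hρmax ν1 hν1reg hν1n
  have hρρ : ρ (ρ n) = ρ n :=
    le_antisymm (hρ _ hρle).2.1 ((hρ _ hρle).2.2 _ hρreg le_rfl)
  -- the bound
  obtain ⟨N, hnN, hN, hkN⟩ : ∃ N, n ≤ N ∧ (∀ k, ρ n < k → k ≤ N → hankelDet m k = 0) ∧
      k < N + ρ n := by
    have hmid : ∀ a, ρ n < a → a ≤ n → hankelDet m a = 0 := by
      intro a ha han
      by_contra hne
      have := hρmax a hne han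
      omega
    rcases hK with ⟨-, h⟩ | ⟨k', rfl, hk', -, h⟩
    · refine ⟨n + k, by omega, fun a ha _ => ?_, by omega⟩
      by_cases han : a ≤ n
      · exact hmid a ha han
      · exact h a (by omega)
    · have hk2 : k ≤ ρ n + k' - 2 := by exact_mod_cast hk
      refine ⟨k' - 1, by omega, fun a ha hak => ?_, by omega⟩
      by_cases han : a ≤ n
      · exact hmid a ha han
      · exact h a (by omega) (by omega)
  have hF := aux_F L m hm (p (ρ n)) (p n) (ρ n) n N (hdeg _ hρle) (hdeg n le_rfl) hρle hρreg
    (by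
      have := horth (ρ n) (by omega) hρle
      rwa [hρρ] at this) (horth n hn le_rfl) hN hnN
  have hLq : L (p n * q) = 0 := by
    by_cases hq0 : q = 0
    · simp [hq0]
    have hpq : (p n * q).degree ≤ ((max k (n - 1) : ℕ) : WithBot ℕ) := by
      rw [← sub_eq_iff_eq_add'.mpr hq]
      refine (degree_sub_le _ _).trans (max_le ?_ ?_)
      · rw [degree_mul, degree_X_pow, hdeg 0 (by omega)]
        have : k + 0 ≤ max k (n - 1) := by omega
        exact_mod_cast this
      · refine (degree_sum_le _ _).trans (Finset.sup_le fun i _ => ?_)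
        rw [← smul_eq_C_mul]
        refine (degree_smul_le _ _).trans ?_
        rw [hdeg i (by omega)]
        have : (i : ℕ) ≤ max k (n - 1) := by omega
        exact_mod_cast this
    rw [degree_mul, hdeg n le_rfl, degree_eq_natDegree hq0] at hpq
    have hle : n + q.natDegree ≤ max k (n - 1) := by exact_mod_cast hpq
    refine aux_L L (p n) q (q.natDegree + 1) (fun i hi => hF i (by omega)) ?_
    rw [degree_eq_natDegree hq0]
    exact_mod_cast Nat.lt_succ_self _
  have hfin := congrArg L hq
  rw [map_add, hLq, add_zero, map_sum, Finset.sum_eq_single ⟨ν1 - 1, by omega⟩] at hfin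
  · rw [← smul_eq_C_mul, map_smul] at hfin
    simp only [smul_eq_mul] at hfin
    rw [hLtop, hp0, mul_comm (X ^ k), ← smul_eq_C_mul, map_smul, ← hm, smul_eq_mul, coeff_C_zero]
      at hfin
    apply mul_left_cancel₀ hc0
    rw [hfin]
    ring
  · intro i _ hi
    rw [← smul_eq_C_mul, map_smul, hLne i i.2 (fun h => hi (Fin.ext h)), smul_zero]
  · simp
end

section
/- Let A be an N×N complex matrix and v, w ∈ ℂ^N, and consider the Markov parameters m_j = w* A^j v for j = 0,1,…. Suppose the triplet (c, S, b), with S an n×n complex matrix and b, c ∈ ℂ^n, is a minimal realization of this sequence, i.e. c* S^j b = m_j for all j ≥ 0, and no triplet (c′, S′, b′) with S′ of size m×m for some m < n satisfies c′* (S′)^j b′ = m_j for all j ≥ 0. Then every eigenvalue of S is an eigenvalue of A (the spectrum of S is a subset of the spectrum of A). -/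
open Matrix

lemma sub_aux (m : ℕ → ℂ) (n : ℕ) (S : Matrix (Fin n) (Fin n) ℂ) (b ψ : Fin n → ℂ)
    (h : ∀ j : ℕ, ψ ⬝ᵥ (S ^ j).mulVec b = m j)
    (W : Submodule ℂ (Fin n → ℂ)) (hinv : ∀ y ∈ W, Matrix.toLin' S y ∈ W) (hb : b ∈ W) :
    ∃ (S' : Matrix (Fin (Module.finrank ℂ W)) (Fin (Module.finrank ℂ W)) ℂ)
      (b' c' : Fin (Module.finrank ℂ W) → ℂ),
      ∀ j : ℕ, c' ⬝ᵥ (S' ^ j).mulVec b' = m j := by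
  let T : W →ₗ[ℂ] W := (Matrix.toLin' S).restrict hinv
  let B := Module.finBasis ℂ W
  have hT : ∀ j : ℕ, (((T ^ j) ⟨b, hb⟩ : W) : Fin n → ℂ) = (S ^ j).mulVec b := by
    intro j
    induction j with
    | zero => simp
    | succ k ih =>
      rw [pow_succ', pow_succ', ← Matrix.mulVec_mulVec, ← ih]
      rfl
  refine ⟨LinearMap.toMatrix B B T, B.repr ⟨b, hb⟩, fun i => ψ ⬝ᵥ (B i : Fin n → ℂ), ?_⟩
  intro j
  have e : (LinearMap.toMatrix B B T) ^ j = LinearMap.toMatrix B B (T ^ j) := by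
    rw [LinearMap.toMatrix_pow]
  rw [e, LinearMap.toMatrix_mulVec_repr, ← h j, ← hT j]
  conv_rhs => rw [← B.sum_repr ((T ^ j) ⟨b, hb⟩)]
  rw [Submodule.coe_sum, dotProduct_sum]
  simp only [Submodule.coe_smul, dotProduct_smul, smul_eq_mul]
  exact Finset.sum_congr rfl (fun i _ => mul_comm _ _)

lemma ctrl_aux (m : ℕ → ℂ) (n : ℕ) (S : Matrix (Fin n) (Fin n) ℂ) (b ψ : Fin n → ℂ)
    (h : ∀ j : ℕ, ψ ⬝ᵥ (S ^ j).mulVec b = m j)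
    (hmin : ∀ m' : ℕ, m' < n → ∀ (S' : Matrix (Fin m') (Fin m') ℂ) (b' c' : Fin m' → ℂ),
      ¬ (∀ j : ℕ, c' ⬝ᵥ (S' ^ j).mulVec b' = m j)) (x : Fin n → ℂ) :
    ∃ q : Polynomial ℂ, (Polynomial.aeval S q).mulVec b = x := by
  let R : Polynomial ℂ →ₗ[ℂ] (Fin n → ℂ) :=
    { toFun := fun q => (Polynomial.aeval S q).mulVec b
      map_add' := fun p q => by simp [Matrix.add_mulVec]
      map_smul' := fun r q => by simp [Matrix.smul_mulVec] }
  let W := LinearMap.range R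
  by_contra hx
  have hW : W ≠ ⊤ := by
    intro hW
    have : x ∈ W := by rw [hW]; trivial
    exact hx this
  have hlt : Module.finrank ℂ W < n := by
    have := Submodule.finrank_lt hW
    simpa using this
  have hinv : ∀ y ∈ W, Matrix.toLin' S y ∈ W := by
    rintro _ ⟨q, rfl⟩
    refine ⟨Polynomial.X * q, ?_⟩
    simp [R, Matrix.mulVec_mulVec]
  have hb : b ∈ W := ⟨1, by simp [R]⟩
  obtain ⟨S', b', c', H⟩ := sub_aux m n S b ψ h W hinv hb
  exact hmin _ hlt S' b' c' H

lemma poly_aux (N n : ℕ) (A : Matrix (Fin N) (Fin N) ℂ) (v w : Fin N → ℂ)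
    (S : Matrix (Fin n) (Fin n) ℂ) (b c : Fin n → ℂ)
    (h : ∀ j : ℕ, c ⬝ᵥ (S ^ j).mulVec b = w ⬝ᵥ (A ^ j).mulVec v) (q : Polynomial ℂ) :
    c ⬝ᵥ (Polynomial.aeval S q).mulVec b = w ⬝ᵥ (Polynomial.aeval A q).mulVec v := by
  induction q using Polynomial.induction_on' with
  | add p q hp hq => simp [Matrix.add_mulVec, hp, hq]
  | monomial k a =>
    simp [Polynomial.aeval_monomial, ← Algebra.smul_def, Matrix.smul_mulVec, h]

lemma transpose_aux (n : ℕ) (S : Matrix (Fin n) (Fin n) ℂ) (q : Polynomial ℂ) :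
    Polynomial.aeval Sᵀ q = (Polynomial.aeval S q)ᵀ := by
  induction q using Polynomial.induction_on' with
  | add p q hp hq => simp [hp, hq]
  | monomial k a =>
    simp [Polynomial.aeval_monomial, ← Algebra.smul_def, Matrix.transpose_pow]

/-- Let `A ∈ M_N(ℂ)`, `v, w ∈ ℂ^N`, with Markov parameters
`m_j = w* A^j v`. If `(c, S, b)` is a minimal realization of this sequence (i.e.
`c* S^j b = m_j` for all `j`, and no realization of smaller dimension exists), then
every eigenvalue of `S` is an eigenvalue of `A`. -/
theorem stmt18 (N n : ℕ) (A : Matrix (Fin N) (Fin N) ℂ) (v w : Fin N → ℂ)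
    (S : Matrix (Fin n) (Fin n) ℂ) (b c : Fin n → ℂ)
    (hreal : ∀ j : ℕ, star c ⬝ᵥ (S ^ j).mulVec b = star w ⬝ᵥ (A ^ j).mulVec v)
    (hmin : ∀ m' : ℕ, m' < n → ∀ (S' : Matrix (Fin m') (Fin m') ℂ) (b' c' : Fin m' → ℂ),
      ¬ (∀ j : ℕ, star c' ⬝ᵥ (S' ^ j).mulVec b' = star w ⬝ᵥ (A ^ j).mulVec v)) :
    ∀ μ : ℂ, (S - μ • 1).det = 0 → (A - μ • 1).det = 0 := by
  intro μ hμ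
  have tr : ∀ (k : ℕ) (M : Matrix (Fin k) (Fin k) ℂ) (x y : Fin k → ℂ),
      x ⬝ᵥ Mᵀ.mulVec y = y ⬝ᵥ M.mulVec x := by
    intro k M x y
    rw [Matrix.mulVec_transpose, dotProduct_comm, ← Matrix.dotProduct_mulVec]
  have h1 := ctrl_aux (fun j => star w ⬝ᵥ (A ^ j).mulVec v) n S b (star c) hreal
    (fun m' hm S' b' c' H => hmin m' hm S' b' (star c') (by simpa using H))
  have h2 := ctrl_aux (fun j => star w ⬝ᵥ (A ^ j).mulVec v) n Sᵀ (star c) b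
    (fun j => by rw [← Matrix.transpose_pow, tr]; exact hreal j)
    (fun m' hm S' b' c' H => hmin m' hm S'ᵀ c' (star b') (fun j => by
      rw [star_star, ← Matrix.transpose_pow, tr]; exact H j))
  have hp : Polynomial.aeval S A.charpoly = 0 := by
    apply Matrix.ext_of_mulVec_single
    intro i
    obtain ⟨q, hq⟩ := h1 (Pi.single i 1)
    rw [Matrix.zero_mulVec, ← hq]
    apply dotProduct_eq_zero
    intro y
    obtain ⟨r, hr⟩ := h2 y
    rw [← hr, transpose_aux, tr, Matrix.mulVec_mulVec, Matrix.mulVec_mulVec, ← map_mul, ← map_mul,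
      poly_aux N n A v (star w) S b (star c) hreal]
    simp [Matrix.aeval_self_charpoly]
  obtain ⟨x, hx0, hx⟩ := Matrix.exists_mulVec_eq_zero_iff.mpr hμ
  have hSx : S.mulVec x = μ • x := by
    rw [Matrix.sub_mulVec, Matrix.smul_mulVec, Matrix.one_mulVec] at hx
    exact sub_eq_zero.mp hx
  have hpow : ∀ k : ℕ, (S ^ k).mulVec x = μ ^ k • x := by
    intro k
    induction k with
    | zero => simp
    | succ k ih => rw [pow_succ, ← Matrix.mulVec_mulVec, hSx, Matrix.mulVec_smul, ih, smul_smul, pow_succ']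
  have hev : ∀ q : Polynomial ℂ, (Polynomial.aeval S q).mulVec x = q.eval μ • x := by
    intro q
    induction q using Polynomial.induction_on' with
    | add p q hp hq => simp [Matrix.add_mulVec, hp, hq, add_smul]
    | monomial k a =>
      simp [Polynomial.aeval_monomial, ← Algebra.smul_def, Matrix.smul_mulVec, hpow, smul_smul]
  have h0 := hev A.charpoly
  rw [hp, Matrix.zero_mulVec] at h0
  have h3 : A.charpoly.eval μ = 0 := (smul_eq_zero.mp h0.symm).resolve_right hx0
  rw [Matrix.eval_charpoly] at h3
  have h4 : A - μ • 1 = -(Matrix.scalar (Fin N) μ - A) := by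
    rw [neg_sub, Matrix.scalar_apply, Matrix.smul_one_eq_diagonal]
  rw [h4, Matrix.det_neg, h3, mul_zero]
end

section
/- Let A be an N×N complex matrix and v, w ∈ ℂ^N, and let L : 𝒫 → ℂ be the linear functional L(p) = w* p(A) v, with moments m_j = w* A^j v and Hankel determinants Δ_k. Suppose an incurable breakdown occurs at step n, i.e. Δ_{n−1} ≠ 0 and Δ_{n+k} = 0 for all k ≥ 0. Then every root of the unique monic formal orthogonal polynomial of degree n with respect to L is an eigenvalue of A (Mismatch Theorem: each Ritz value is an eigenvalue of A). -/
open Polynomial Matrix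

lemma aux_nondeg (L : ℂ[X] →ₗ[ℂ] ℂ) (n : ℕ) (h : hankelDet (fun j => L (X ^ j)) n ≠ 0)
    (q : ℂ[X]) (hq : q.degree < n) (hL : ∀ j < n, L (q * X ^ j) = 0) : q = 0 := by
  have h0 : (fun j : Fin n => q.coeff j) = 0 := by
    by_contra hne
    apply h
    unfold hankelDet
    refine Matrix.exists_mulVec_eq_zero_iff.mp ⟨_, hne, ?_⟩
    funext i
    have h1 := hL i i.2
    have h2 : q = ∑ j : Fin n, q.coeff j • (X : ℂ[X]) ^ (j : ℕ) := by
      rw [Fin.sum_univ_eq_sum_range (fun j => q.coeff j • (X : ℂ[X]) ^ j)]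
      rcases eq_or_ne q 0 with rfl | hq0
      · simp
      · conv_lhs => rw [q.as_sum_range' n ((natDegree_lt_iff_degree_lt hq0).2 hq)]
        simp [← smul_X_eq_monomial]
    rw [h2, Finset.sum_mul, map_sum] at h1
    simp only [Matrix.mulVec, dotProduct, Matrix.of_apply, Pi.zero_apply]
    rw [← h1]
    refine Finset.sum_congr rfl fun j _ => ?_
    rw [smul_mul_assoc, map_smul, smul_eq_mul, mul_comm, ← pow_add, add_comm (i : ℕ)]
  ext i
  by_cases hi : i < n
  · simpa using congrFun h0 ⟨i, hi⟩
  · rw [coeff_zero]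
    exact coeff_eq_zero_of_degree_lt (hq.trans_le (by exact_mod_cast not_lt.mp hi))

lemma aux_deg_s19 (L : ℂ[X] →ₗ[ℂ] ℂ) (n : ℕ) (h : hankelDet (fun j => L (X ^ j)) n = 0) :
    ∃ q : ℂ[X], q ≠ 0 ∧ q.degree < n ∧ ∀ j < n, L (q * X ^ j) = 0 := by
  unfold hankelDet at h
  obtain ⟨x, hx, hx0⟩ := Matrix.exists_mulVec_eq_zero_iff.mpr h
  refine ⟨∑ j : Fin n, C (x j) * X ^ (j : ℕ), ?_, degree_sum_fin_lt x, ?_⟩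
  · intro h0
    apply hx
    funext i
    have := congrArg (fun p => p.coeff (i : ℕ)) h0
    simpa [finsetSum_coeff, coeff_X_pow, Fin.val_inj] using this
  · intro i hi
    have h1 := congrFun hx0 ⟨i, hi⟩
    simp only [Matrix.mulVec, dotProduct, Matrix.of_apply, Pi.zero_apply] at h1
    rw [Finset.sum_mul, map_sum, ← h1]
    refine Finset.sum_congr rfl fun j _ => ?_
    rw [← smul_eq_C_mul, smul_mul_assoc, map_smul, smul_eq_mul, mul_comm, ← pow_add,
      add_comm (i : ℕ)]

lemma aux_ext (L : ℂ[X] →ₗ[ℂ] ℂ) (p : ℂ[X]) (M : ℕ) (h : ∀ j < M, L (p * X ^ j) = 0)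
    (t : ℂ[X]) (ht : t.degree < M) : L (p * t) = 0 := by
  rcases eq_or_ne t 0 with rfl | ht0
  · simp
  rw [t.as_sum_range' M ((natDegree_lt_iff_degree_lt ht0).2 ht), Finset.mul_sum, map_sum]
  refine Finset.sum_eq_zero fun j hj => ?_
  rw [← smul_X_eq_monomial, mul_smul_comm, map_smul, h j (Finset.mem_range.mp hj), smul_zero]

lemma aux_all (L : ℂ[X] →ₗ[ℂ] ℂ) (n : ℕ) (hreg : hankelDet (fun j => L (X ^ j)) n ≠ 0)
    (hbreak : ∀ k : ℕ, hankelDet (fun j => L (X ^ j)) (n + 1 + k) = 0)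
    (p : ℂ[X]) (hmonic : p.Monic) (hdeg : p.natDegree = n)
    (hFOP : ∀ j < n, L (p * X ^ j) = 0) (j : ℕ) : L (p * X ^ j) = 0 := by
  induction j using Nat.strong_induction_on with
  | _ j ih =>
  by_cases hj : j < n
  · exact hFOP j hj
  obtain ⟨k, rfl⟩ := Nat.exists_eq_add_of_le (not_lt.mp hj)
  obtain ⟨q, hq0, hqd, hqL⟩ := aux_deg_s19 L _ (hbreak k)
  have hqn : q.natDegree < n + 1 + k := (natDegree_lt_iff_degree_lt hq0).2 hqd
  have hpd : p.degree = n := by rw [degree_eq_natDegree hmonic.ne_zero, hdeg]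
  have hdiv := modByMonic_add_div q p
  have hsn : (q /ₘ p).natDegree ≤ k := by
    rw [natDegree_divByMonic q hmonic]; omega
  set s := q /ₘ p with hs
  have hr : q %ₘ p = 0 := by
    refine aux_nondeg L n hreg _ (hpd ▸ degree_modByMonic_lt q hmonic) fun i hi => ?_
    have h1 := hqL i (by omega)
    rw [← hdiv, add_mul, map_add, mul_assoc, aux_ext L p (n + k) ih (s * X ^ i), add_zero] at h1
    · exact h1
    · refine lt_of_le_of_lt degree_le_natDegree ?_
      have := natDegree_mul_le (p := s) (q := X ^ i)
      rw [natDegree_X_pow] at this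
      exact_mod_cast (by omega : (s * X ^ i).natDegree < n + k)
  rw [hr, zero_add] at hdiv
  have hs0 : s ≠ 0 := by
    intro h; apply hq0; rw [← hdiv, h, mul_zero]
  obtain ⟨e, he⟩ : ∃ e, n + k = s.natDegree + e := Nat.exists_eq_add_of_le (by omega)
  have h1 := hqL e (by omega)
  rw [← hdiv, mul_assoc] at h1
  have hsplit : s = s.eraseLead + s.leadingCoeff • X ^ s.natDegree := by
    rw [smul_eq_C_mul]; exact (eraseLead_add_C_mul_X_pow s).symm
  have h2 : L (p * (s.eraseLead * X ^ e)) = 0 := by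
    refine aux_ext L p (n + k) ih _ ?_
    rw [degree_mul, degree_X_pow, he]
    rcases eq_or_ne s.eraseLead 0 with h | h
    · rw [h, degree_zero, WithBot.bot_add]; exact WithBot.bot_lt_coe _
    · have h3 := degree_eraseLead_lt hs0
      rw [degree_eq_natDegree h, degree_eq_natDegree hs0] at h3
      rw [degree_eq_natDegree h]
      have h4 : s.eraseLead.natDegree < s.natDegree := by exact_mod_cast h3
      exact_mod_cast Nat.add_lt_add_right h4 e
  have h3 : p * (s * X ^ e) = p * (s.eraseLead * X ^ e) + s.leadingCoeff • (p * X ^ (n + k)) := by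
    conv_lhs => rw [hsplit]
    rw [he, add_mul, mul_add, smul_mul_assoc, mul_smul_comm, ← pow_add]
  rw [h3, map_add, h2, zero_add, map_smul, smul_eq_mul] at h1
  exact (mul_eq_zero.mp h1).resolve_left (leadingCoeff_ne_zero.mpr hs0)

/-- Mismatch Theorem. Let `L(q) = w* q(A) v` with moments
`m_j = w* A^j v`, and suppose an incurable breakdown occurs at step `n`:
`Δ_{n−1} ≠ 0` and `Δ_{n+k} = 0` for all `k ≥ 0`. Then every root of the unique monic
formal orthogonal polynomial of degree `n` w.r.t. `L` (Ritz value) is an eigenvalue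
of `A`. -/
theorem stmt19 (N n : ℕ) (A : Matrix (Fin N) (Fin N) ℂ) (v w : Fin N → ℂ)
    (m : ℕ → ℂ) (hm : ∀ j, m j = star w ⬝ᵥ ((A ^ j).mulVec v))
    (hreg : hankelDet m n ≠ 0)
    (hbreak : ∀ k : ℕ, hankelDet m (n + 1 + k) = 0)
    (p : Polynomial ℂ) (hmonic : p.Monic) (hdeg : p.natDegree = n)
    (hFOP : ∀ j < n, star w ⬝ᵥ ((Polynomial.aeval A (p * X ^ j)).mulVec v) = 0) :
    ∀ μ : ℂ, p.IsRoot μ → (A - μ • 1).det = 0 := by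
  intro μ hμ
  let L : ℂ[X] →ₗ[ℂ] ℂ :=
    { toFun := fun q => star w ⬝ᵥ ((Polynomial.aeval A q).mulVec v)
      map_add' := fun a b => by rw [map_add, add_mulVec, dotProduct_add]
      map_smul' := fun c a => by
        rw [map_smul, smul_mulVec, dotProduct_smul, RingHom.id_apply] }
  have hL : ∀ q, L q = star w ⬝ᵥ ((Polynomial.aeval A q).mulVec v) := fun q => rfl
  have hmL : m = fun j => L (X ^ j) := by
    funext j; rw [hm, hL, map_pow, aeval_X]
  rw [hmL] at hreg
  have hall := aux_all L n hreg (by rw [← hmL]; exact hbreak) p hmonic hdeg hFOP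
  have hall' : ∀ t, L (p * t) = 0 := fun t =>
    aux_ext L p (t.natDegree + 1) (fun j _ => hall j) t
      (lt_of_le_of_lt degree_le_natDegree (by exact_mod_cast Nat.lt_succ_self _))
  by_contra hdet
  have hχ : A.charpoly.eval μ ≠ 0 := by
    rw [Matrix.eval_charpoly]
    intro h
    apply hdet
    have : A - μ • 1 = -(Matrix.scalar (Fin N) μ - A) := by
      rw [neg_sub, Matrix.smul_one_eq_diagonal, Matrix.scalar_apply]
    rw [this, Matrix.det_neg, h, mul_zero]
  have hcop : IsCoprime (X - C μ) A.charpoly := by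
    refine (irreducible_X_sub_C μ).coprime_iff_not_dvd.mpr ?_
    rw [dvd_iff_isRoot]; exact hχ
  obtain ⟨a, b, hab⟩ := hcop
  obtain ⟨q, hq⟩ := dvd_iff_isRoot.mpr hμ
  have hq0 : q ≠ 0 := by
    rintro rfl; exact hmonic.ne_zero (by rw [hq, mul_zero])
  apply hq0
  refine aux_nondeg L n hreg q ?_ fun j _ => ?_
  · rw [← natDegree_lt_iff_degree_lt hq0, ← hdeg, hq, natDegree_mul (X_sub_C_ne_zero μ) hq0,
      natDegree_X_sub_C]
    omega
  · have h1 : q * X ^ j = p * (a * X ^ j) + A.charpoly * (b * q * X ^ j) := by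
      rw [hq]; linear_combination (-(q * X ^ j)) * hab
    rw [h1, map_add, hall', zero_add, hL, map_mul, Matrix.aeval_self_charpoly, zero_mul,
      zero_mulVec, dotProduct_zero]
end
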